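/- arXiv:2602.02800 — 7 statements merged into one kernel-verified Lean document; each statement's English description precedes it below -/
import Mathlib

section
/- Let X be a random vector in ℝ^d with law μ, let κ be a nonnegative random scalar (possibly dependent on X), and let ν be the law of Y := κX. Assume the oracle selection satisfies w*(cx) = w*(x) for every x ∈ ℝ^d and every scalar c > 0. Then the optimistic decision-focused distance satisfies W^O_DF(μ,ν) = 0. -/
open MeasureTheory Set
open scoped RealInnerProductSpace ENNReal

noncomputable section

/-- `ℝ^d` with the Euclidean inner product. -/
abbrev Vec (d : ℕ) := EuclideanSpace ℝ (Fin d)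

/-- `γ` is a coupling of `μ` and `ν`: a measure on the product whose marginals are `μ`, `ν`. -/
def IsCoupling {α β : Type*} [MeasurableSpace α] [MeasurableSpace β]
    (μ : Measure α) (ν : Measure β) (γ : Measure (α × β)) : Prop :=
  γ.map Prod.fst = μ ∧ γ.map Prod.snd = ν

/-- The SPO loss `ℓ_SPO(x,y) = yᵀ w*(x) − yᵀ w*(y)`. -/
def spoLoss {d : ℕ} (wstar : Vec d → Vec d) (x y : Vec d) : ℝ :=
  ⟪y, wstar x⟫ - ⟪y, wstar y⟫

/-- The optimistic decision-focused distance `W^O_DF(μ,ν) = inf_{γ ∈ Γ(μ,ν)} ∫ ℓ_SPO dγ`. -/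
def WDFO {d : ℕ} (wstar : Vec d → Vec d) (μ ν : Measure (Vec d)) : ℝ :=
  sInf {r | ∃ γ : Measure (Vec d × Vec d), IsCoupling μ ν γ ∧
    r = ∫ p, spoLoss wstar p.1 p.2 ∂γ}

/-- **Random rescaling yields zero optimistic DF distance.**
If `Y = κ • X` with `κ` a nonnegative random scalar (possibly dependent on `X`), and the
oracle selection is scale invariant (`w*(c x) = w*(x)` for all `c > 0`), then
`W^O_DF(law X, law Y) = 0`. -/
theorem stmt0 {d : ℕ} (S : Set (Vec d)) (𝔖 : Finset (Vec d)) (wstar : Vec d → Vec d)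
    (hSne : S.Nonempty) (hScomp : IsCompact S)
    (hext : (𝔖 : Set (Vec d)) = S.extremePoints ℝ)
    (hwmeas : Measurable wstar) (hwmem : ∀ x, wstar x ∈ 𝔖)
    (hwopt : ∀ x : Vec d, ∀ w ∈ S, ⟪wstar x, x⟫ ≤ ⟪w, x⟫)
    (hscale : ∀ (x : Vec d) (c : ℝ), 0 < c → wstar (c • x) = wstar x)
    {Ω : Type*} [MeasurableSpace Ω] (P : Measure Ω) [IsProbabilityMeasure P]
    (X : Ω → Vec d) (κ : Ω → ℝ) (hX : Measurable X) (hκ : Measurable κ)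
    (hκ0 : ∀ ω, 0 ≤ κ ω)
    (μ ν : Measure (Vec d)) (hμ : μ = P.map X)
    (hν : ν = P.map (fun ω => κ ω • X ω)) :
    WDFO wstar μ ν = 0 := by
  have hnn : ∀ x y, 0 ≤ spoLoss wstar x y := by
    intro x y
    have hm : wstar x ∈ S := by
      have h : wstar x ∈ (𝔖 : Set (Vec d)) := by exact_mod_cast hwmem x
      rw [hext] at h
      exact extremePoints_subset h
    have h := hwopt y _ hm
    unfold spoLoss
    rw [real_inner_comm (wstar x) y, real_inner_comm (wstar y) y]
    linarith
  have hY : Measurable (fun ω => κ ω • X ω) := hκ.smul hX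
  have hloss : Measurable (fun p : Vec d × Vec d => spoLoss wstar p.1 p.2) := by
    unfold spoLoss
    exact (measurable_snd.inner (hwmeas.comp measurable_fst)).sub
      (measurable_snd.inner (hwmeas.comp measurable_snd))
  have hle : ∀ r ∈ {r | ∃ γ : Measure (Vec d × Vec d), IsCoupling μ ν γ ∧
      r = ∫ p, spoLoss wstar p.1 p.2 ∂γ}, 0 ≤ r := by
    rintro r ⟨γ, -, rfl⟩
    exact integral_nonneg fun p => hnn _ _
  refine le_antisymm (csInf_le ⟨0, hle⟩ ?_) (Real.sInf_nonneg hle)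
  refine ⟨P.map (fun ω => (X ω, κ ω • X ω)), ⟨?_, ?_⟩, ?_⟩
  · rw [Measure.map_map measurable_fst (hX.prodMk hY), hμ]
    rfl
  · rw [Measure.map_map measurable_snd (hX.prodMk hY), hν]
    rfl
  · rw [integral_map (hX.prodMk hY).aemeasurable hloss.aestronglyMeasurable]
    symm
    refine integral_eq_zero_of_ae (Filter.Eventually.of_forall fun ω => ?_)
    rcases (hκ0 ω).eq_or_lt with h | h
    · simp [spoLoss, ← h]
    · simp [spoLoss, hscale _ _ h]
end
end

section
/- Suppose μ and ν are probability measures supported on a bounded set 𝒴 ⊂ ℝ^d with diameter ‖𝒴‖ := sup{‖x−y‖₂ : x,y ∈ 𝒴}. Then W^O_DF(μ,ν) ≤ W^O_sym(μ,ν) ≤ D_W · W₁(μ,ν) ≤ D_W · ‖𝒴‖ · d_TV(μ,ν). Moreover, whenever KL(μ‖ν) < ∞, one has W^O_sym(μ,ν) ≤ D_W · ‖𝒴‖ · √(KL(μ‖ν)/2). -/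
open MeasureTheory Set
open scoped RealInnerProductSpace ENNReal

noncomputable section

/-- The 1-Wasserstein distance `W₁(P,Q) = inf_{π ∈ Γ(P,Q)} ∫ ‖x−y‖ dπ`. -/
def W1 {d : ℕ} (P Q : Measure (Vec d)) : ℝ :=
  sInf {r | ∃ π : Measure (Vec d × Vec d), IsCoupling P Q π ∧
    r = ∫ p, ‖p.1 - p.2‖ ∂π}

/-- Total variation distance `d_TV(P,Q) = sup_A |P(A) − Q(A)|`. -/
def tvDist {α : Type*} [MeasurableSpace α] (P Q : Measure α) : ℝ :=
  ⨆ A : {A : Set α // MeasurableSet A}, |(P A.1).toReal - (Q A.1).toReal|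

/-- Kullback–Leibler divergence `KL(P‖Q) = ∫ log (dP/dQ) dP`, as a real number
(meaningful under `KLFinite P Q`). -/
def klDivReal {α : Type*} [MeasurableSpace α] (P Q : Measure α) : ℝ :=
  ∫ x, llr P Q x ∂P

/-- `KL(P‖Q) < ∞`: absolute continuity together with integrability of the
log-likelihood ratio. -/
def KLFinite {α : Type*} [MeasurableSpace α] (P Q : Measure α) : Prop :=
  P ≪ Q ∧ Integrable (llr P Q) P

lemma aux_coupling_prob {α β : Type*} [MeasurableSpace α] [MeasurableSpace β]
    {μ : Measure α} {ν : Measure β} [IsProbabilityMeasure μ] {γ : Measure (α × β)}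
    (h : IsCoupling μ ν γ) : IsProbabilityMeasure γ := by
  constructor
  have h1 : γ.map Prod.fst univ = 1 := by rw [h.1]; simp
  rwa [Measure.map_apply measurable_fst MeasurableSet.univ, preimage_univ] at h1

lemma aux_coupling_prod {α β : Type*} [MeasurableSpace α] [MeasurableSpace β]
    (μ : Measure α) (ν : Measure β) [IsProbabilityMeasure μ] [IsProbabilityMeasure ν] :
    IsCoupling μ ν (μ.prod ν) := by
  constructor
  · simp [Measure.map_fst_prod]
  · simp [Measure.map_snd_prod]

lemma aux_coupling_swap {α β : Type*} [MeasurableSpace α] [MeasurableSpace β]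
    {μ : Measure α} {ν : Measure β} {γ : Measure (α × β)}
    (h : IsCoupling μ ν γ) : IsCoupling ν μ (γ.map Prod.swap) := by
  constructor
  · rw [Measure.map_map measurable_fst measurable_swap]; exact h.2
  · rw [Measure.map_map measurable_snd measurable_swap]; exact h.1

lemma aux_coupling_ae {α β : Type*} [MeasurableSpace α] [MeasurableSpace β]
    {μ : Measure α} {ν : Measure β} {γ : Measure (α × β)}
    (h : IsCoupling μ ν γ) {A : Set α} {B : Set β} (hA : μ Aᶜ = 0) (hB : ν Bᶜ = 0) :
    ∀ᵐ p ∂γ, p.1 ∈ A ∧ p.2 ∈ B := by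
  have h1 : ∀ᵐ p ∂γ, p.1 ∈ A := by
    apply ae_of_ae_map measurable_fst.aemeasurable (p := fun x => x ∈ A)
    rw [h.1]; exact hA
  have h2 : ∀ᵐ p ∂γ, p.2 ∈ B := by
    apply ae_of_ae_map measurable_snd.aemeasurable (p := fun x => x ∈ B)
    rw [h.2]; exact hB
  exact h1.and h2

/-- Pinsker for a single event. -/
lemma aux_pinsker {α : Type*} [MeasurableSpace α] (μ ν : Measure α)
    [IsProbabilityMeasure μ] [IsProbabilityMeasure ν] (h : KLFinite μ ν)
    {A : Set α} (hA : MeasurableSet A) :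
    2 * (μ.real A - ν.real A) ^ 2 ≤ klDivReal μ ν := by
  set s : ℝ := 4 * (μ.real A - ν.real A) with hs
  set X : α → ℝ := A.indicator (fun _ => (1 : ℝ)) with hX
  have hXm : Measurable X := measurable_const.indicator hA
  have hX01 : ∀ x, X x ∈ Icc (0 : ℝ) 1 := by
    intro x; by_cases hx : x ∈ A <;> simp [hX, hx]
  have hXν : ∫ x, X x ∂ν = ν.real A := by simp [hX, integral_indicator hA]
  have hXμ : ∫ x, X x ∂μ = μ.real A := by simp [hX, integral_indicator hA]
  have hsub := ProbabilityTheory.hasSubgaussianMGF_of_mem_Icc (μ := ν) hXm.aemeasurable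
    (Filter.Eventually.of_forall hX01)
  have hexp : Integrable (fun x => Real.exp (s * X x)) ν :=
    ProbabilityTheory.integrable_exp_mul_of_mem_Icc hXm.aemeasurable
      (Filter.Eventually.of_forall hX01)
  have hXi : Integrable X μ := Integrable.of_mem_Icc 0 1 hXm.aemeasurable
    (Filter.Eventually.of_forall hX01)
  have hmgf := hsub.mgf_le s
  have e1 : ProbabilityTheory.mgf (fun ω ↦ X ω - ∫ x, X x ∂ν) ν s
      = Real.exp (-(s * ν.real A)) * ∫ x, Real.exp (s * X x) ∂ν := by
    rw [ProbabilityTheory.mgf, ← integral_const_mul, hXν]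
    congr 1; ext x; rw [← Real.exp_add]; congr 1; ring
  rw [e1] at hmgf
  have hpos : 0 < ∫ x, Real.exp (s * X x) ∂ν := integral_exp_pos hexp
  have hlog := Real.log_le_log (by positivity) hmgf
  rw [Real.log_mul (by positivity) hpos.ne', Real.log_exp, Real.log_exp] at hlog
  have hi := integral_llr_tilted_right h.1 (hXi.const_mul s) hexp h.2
  have hii := integrable_llr_tilted_right h.1 (hXi.const_mul s) h.2 hexp
  have hac : μ ≪ ν.tilted (fun x => s * X x) := h.1.trans (absolutelyContinuous_tilted hexp)
  haveI : IsProbabilityMeasure (ν.tilted (fun x => s * X x)) := isProbabilityMeasure_tilted hexp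
  have hg := InformationTheory.integral_llr_add_sub_measure_univ_nonneg hac hii
  rw [hi, integral_const_mul, hXμ] at hg
  simp at hg hlog
  unfold klDivReal
  norm_num at hlog
  nlinarith

lemma aux_tv_le {α : Type*} [MeasurableSpace α] (μ ν : Measure α)
    [IsProbabilityMeasure μ] [IsProbabilityMeasure ν] {A : Set α} (hA : MeasurableSet A) :
    |μ.real A - ν.real A| ≤ tvDist μ ν := by
  refine le_ciSup (f := fun A : {A : Set α // MeasurableSet A} =>
    |(μ A.1).toReal - (ν A.1).toReal|) ⟨1, ?_⟩ ⟨A, hA⟩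
  rintro _ ⟨B, rfl⟩
  have h1 : μ.real B.1 ≤ 1 := measureReal_le_one
  have h2 : ν.real B.1 ≤ 1 := measureReal_le_one
  have h3 : 0 ≤ μ.real B.1 := measureReal_nonneg
  have h4 : 0 ≤ ν.real B.1 := measureReal_nonneg
  simp only [measureReal_def] at h1 h2 h3 h4
  exact abs_le.2 ⟨by linarith, by linarith⟩

lemma aux_tv_pinsker {α : Type*} [MeasurableSpace α] (μ ν : Measure α)
    [IsProbabilityMeasure μ] [IsProbabilityMeasure ν] (h : KLFinite μ ν) :
    tvDist μ ν ≤ Real.sqrt (klDivReal μ ν / 2) := by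
  haveI : Nonempty {A : Set α // MeasurableSet A} := ⟨⟨∅, MeasurableSet.empty⟩⟩
  refine ciSup_le fun A => ?_
  apply Real.abs_le_sqrt
  have := aux_pinsker μ ν h A.2
  simp only [measureReal_def] at this
  linarith

/-- Maximal coupling. -/
lemma aux_max_coupling {α : Type*} [MeasurableSpace α] (μ ν : Measure α)
    [IsProbabilityMeasure μ] [IsProbabilityMeasure ν] :
    ∃ (m : Measure α) (r : Measure (α × α)), IsCoupling μ ν (m.map (fun x => (x, x)) + r) ∧
      r univ ≤ ENNReal.ofReal (tvDist μ ν) := by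
  obtain ⟨s, hs⟩ := exists_isHahnDecomposition μ ν
  have hsm := hs.measurableSet
  have h1 : μ.restrict s ≤ ν.restrict s := hs.le_on
  have h2 : ν.restrict sᶜ ≤ μ.restrict sᶜ := hs.ge_on_compl
  set m := μ.restrict s + ν.restrict sᶜ with hm
  set a := μ.restrict sᶜ - ν.restrict sᶜ with ha
  set b := ν.restrict s - μ.restrict s with hb
  have hμ : m + a = μ := by
    rw [hm, add_assoc, add_comm (ν.restrict sᶜ), Measure.sub_add_cancel_of_le h2,
      Measure.restrict_add_restrict_compl hsm]
  have hν : m + b = ν := by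
    rw [hm, add_comm (μ.restrict s), add_assoc, add_comm (μ.restrict s),
      Measure.sub_add_cancel_of_le h1, add_comm, Measure.restrict_add_restrict_compl hsm]
  haveI : IsFiniteMeasure a := isFiniteMeasure_of_le _ Measure.sub_le
  haveI : IsFiniteMeasure b := isFiniteMeasure_of_le _ Measure.sub_le
  have hab : a univ = b univ := by
    have e1 : m univ + a univ = 1 := by rw [← Measure.add_apply, hμ]; simp
    have e2 : m univ + b univ = 1 := by rw [← Measure.add_apply, hν]; simp
    have : m univ ≠ ∞ := measure_ne_top m univ
    exact (ENNReal.add_right_inj this).1 (e1.trans e2.symm)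
  have hmeas : Measurable (fun x : α => (x, x)) := measurable_id.prodMk measurable_id
  have hau : a univ = ENNReal.ofReal (μ.real sᶜ - ν.real sᶜ) := by
    rw [ha, Measure.sub_apply MeasurableSet.univ h2, Measure.restrict_apply_univ,
      Measure.restrict_apply_univ, ENNReal.ofReal_sub _ measureReal_nonneg,
      ofReal_measureReal, ofReal_measureReal]
  have htv : a univ ≤ ENNReal.ofReal (tvDist μ ν) := by
    rw [hau]
    exact ENNReal.ofReal_le_ofReal ((le_abs_self _).trans (aux_tv_le μ ν hsm.compl))
  by_cases h0 : a univ = 0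
  · have ha0 : a = 0 := Measure.measure_univ_eq_zero.1 h0
    have hb0 : b = 0 := Measure.measure_univ_eq_zero.1 (hab ▸ h0)
    refine ⟨m, 0, ⟨?_, ?_⟩, by simp⟩
    · rw [add_zero, Measure.map_map measurable_fst hmeas]
      conv_rhs => rw [← hμ, ha0, add_zero]
      exact Measure.map_id
    · rw [add_zero, Measure.map_map measurable_snd hmeas]
      conv_rhs => rw [← hν, hb0, add_zero]
      exact Measure.map_id
  · have hfin : a univ ≠ ∞ := measure_ne_top a univ
    refine ⟨m, (a univ)⁻¹ • a.prod b, ⟨?_, ?_⟩, ?_⟩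
    · rw [Measure.map_add _ _ measurable_fst, Measure.map_map measurable_fst hmeas,
        Measure.map_smul, Measure.map_fst_prod, ← hab, smul_smul,
        ENNReal.inv_mul_cancel h0 hfin, one_smul]
      conv_rhs => rw [← hμ]
      congr 1
      exact Measure.map_id
    · rw [Measure.map_add _ _ measurable_snd, Measure.map_map measurable_snd hmeas,
        Measure.map_smul, Measure.map_snd_prod, smul_smul,
        ENNReal.inv_mul_cancel h0 hfin, one_smul]
      conv_rhs => rw [← hν]
      congr 1
      exact Measure.map_id
    · rw [Measure.smul_apply, ← univ_prod_univ, Measure.prod_prod, ← hab, smul_eq_mul,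
        ← mul_assoc, ENNReal.inv_mul_cancel h0 hfin, one_mul]
      exact htv

lemma aux_tv_nonneg {α : Type*} [MeasurableSpace α] (μ ν : Measure α) :
    0 ≤ tvDist μ ν := Real.iSup_nonneg fun _ => abs_nonneg _

lemma aux_W1_le {d : ℕ} (𝒴 : Set (Vec d)) (h𝒴 : Bornology.IsBounded 𝒴)
    (μ ν : Measure (Vec d)) [IsProbabilityMeasure μ] [IsProbabilityMeasure ν]
    (hμsupp : μ 𝒴ᶜ = 0) (hνsupp : ν 𝒴ᶜ = 0) :
    W1 μ ν ≤ Metric.diam 𝒴 * tvDist μ ν := by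
  obtain ⟨m, r, hc, hr⟩ := aux_max_coupling μ ν
  have hmeas : Measurable (fun x : Vec d => (x, x)) := measurable_id.prodMk measurable_id
  haveI := aux_coupling_prob hc
  have hae : ∀ᵐ p ∂(m.map (fun x => (x, x)) + r), ‖p.1 - p.2‖ ≤ Metric.diam 𝒴 := by
    filter_upwards [aux_coupling_ae hc hμsupp hνsupp] with p hp
    rw [← dist_eq_norm]
    exact Metric.dist_le_diam_of_mem h𝒴 hp.1 hp.2
  have hint : Integrable (fun p : Vec d × Vec d => ‖p.1 - p.2‖)
      (m.map (fun x => (x, x)) + r) := by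
    refine Integrable.of_bound (by fun_prop) (Metric.diam 𝒴) ?_
    filter_upwards [hae] with p hp
    simpa using hp
  haveI : IsFiniteMeasure r := ⟨hr.trans_lt ENNReal.ofReal_lt_top⟩
  have hle : W1 μ ν ≤ ∫ p, ‖p.1 - p.2‖ ∂(m.map (fun x => (x, x)) + r) := by
    refine csInf_le ⟨0, ?_⟩ ⟨_, hc, rfl⟩
    rintro _ ⟨π, -, rfl⟩
    exact integral_nonneg fun _ => norm_nonneg _
  refine hle.trans ?_
  rw [integrable_add_measure] at hint
  rw [integral_add_measure hint.1 hint.2,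
    integral_map hmeas.aemeasurable (by fun_prop)]
  rw [ae_add_measure_iff] at hae
  have h2 : ∫ p, ‖p.1 - p.2‖ ∂r ≤ ∫ p, Metric.diam 𝒴 ∂r :=
    integral_mono_ae hint.2 (integrable_const _) hae.2
  rw [integral_const, smul_eq_mul] at h2
  have h3 : r.real univ ≤ tvDist μ ν :=
    ENNReal.toReal_le_of_le_ofReal (aux_tv_nonneg μ ν) hr
  have h4 : r.real univ * Metric.diam 𝒴 ≤ tvDist μ ν * Metric.diam 𝒴 :=
    mul_le_mul_of_nonneg_right h3 Metric.diam_nonneg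
  simp only [sub_self, norm_zero, integral_zero, zero_add]
  linarith

/-- **The optimistic DF distance is Lipschitz with respect to the `W₁` distance.**
For `μ, ν` supported on a bounded set `𝒴`:
`W^O_DF(μ,ν) ≤ W^O_sym(μ,ν) ≤ D_W · W₁(μ,ν) ≤ D_W · ‖𝒴‖ · d_TV(μ,ν)`, and whenever
`KL(μ‖ν) < ∞` also `W^O_sym(μ,ν) ≤ D_W · ‖𝒴‖ · √(KL(μ‖ν)/2)`. Here `D_W = diam S` and
`‖𝒴‖ = diam 𝒴`, and `W^O_sym(μ,ν) = W^O_DF(μ,ν) + W^O_DF(ν,μ)`. -/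
theorem stmt1 {d : ℕ} (S : Set (Vec d)) (𝔖 : Finset (Vec d)) (wstar : Vec d → Vec d)
    (hSne : S.Nonempty) (hScomp : IsCompact S)
    (hext : (𝔖 : Set (Vec d)) = S.extremePoints ℝ)
    (hwmeas : Measurable wstar) (hwmem : ∀ x, wstar x ∈ 𝔖)
    (hwopt : ∀ x : Vec d, ∀ w ∈ S, ⟪wstar x, x⟫ ≤ ⟪w, x⟫)
    (𝒴 : Set (Vec d)) (h𝒴 : Bornology.IsBounded 𝒴)
    (μ ν : Measure (Vec d)) [IsProbabilityMeasure μ] [IsProbabilityMeasure ν]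
    (hμsupp : μ 𝒴ᶜ = 0) (hνsupp : ν 𝒴ᶜ = 0) :
    WDFO wstar μ ν ≤ WDFO wstar μ ν + WDFO wstar ν μ ∧
    WDFO wstar μ ν + WDFO wstar ν μ ≤ Metric.diam S * W1 μ ν ∧
    Metric.diam S * W1 μ ν ≤ Metric.diam S * Metric.diam 𝒴 * tvDist μ ν ∧
    (KLFinite μ ν →
      WDFO wstar μ ν + WDFO wstar ν μ ≤
        Metric.diam S * Metric.diam 𝒴 * Real.sqrt (klDivReal μ ν / 2)) := by
  have hwS : ∀ x, wstar x ∈ S := fun x => by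
    have : wstar x ∈ S.extremePoints ℝ := by rw [← hext]; exact hwmem x
    exact this.1
  have hnn : ∀ x y, 0 ≤ spoLoss wstar x y := by
    intro x y
    have := hwopt y (wstar x) (hwS x)
    unfold spoLoss
    rw [real_inner_comm (wstar x), real_inner_comm (wstar y)]
    linarith
  have hW0 : ∀ P Q : Measure (Vec d), 0 ≤ WDFO wstar P Q := by
    intro P Q
    apply Real.sInf_nonneg
    rintro _ ⟨γ, -, rfl⟩
    exact integral_nonneg fun p => hnn _ _
  have hWle : ∀ (P Q : Measure (Vec d)) (γ), IsCoupling P Q γ →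
      WDFO wstar P Q ≤ ∫ p, spoLoss wstar p.1 p.2 ∂γ := by
    intro P Q γ hγ
    refine csInf_le ⟨0, ?_⟩ ⟨_, hγ, rfl⟩
    rintro _ ⟨π, -, rfl⟩
    exact integral_nonneg fun p => hnn _ _
  have hSb : Bornology.IsBounded S := hScomp.isBounded
  have hmeasL : Measurable (fun p : Vec d × Vec d => spoLoss wstar p.1 p.2) := by
    unfold spoLoss
    exact (measurable_snd.inner (hwmeas.comp measurable_fst)).sub
      (measurable_snd.inner (hwmeas.comp measurable_snd))
  obtain ⟨C, hC⟩ := h𝒴.exists_norm_le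
  have hbd : ∀ x y, y ∈ 𝒴 → ‖spoLoss wstar x y‖ ≤ C * Metric.diam S := by
    intro x y hy
    unfold spoLoss
    rw [← inner_sub_right]
    refine (norm_inner_le_norm _ _).trans ?_
    refine mul_le_mul (hC y hy) ?_ (norm_nonneg _) ((norm_nonneg _).trans (hC y hy))
    rw [← dist_eq_norm]
    exact Metric.dist_le_diam_of_mem hSb (hwS x) (hwS y)
  have key : ∀ π, IsCoupling μ ν π →
      WDFO wstar μ ν + WDFO wstar ν μ ≤ Metric.diam S * ∫ p, ‖p.1 - p.2‖ ∂π := by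
    intro π hπ
    haveI := aux_coupling_prob hπ
    have hae := aux_coupling_ae hπ hμsupp hνsupp
    have h1 := hWle _ _ _ hπ
    have h2 := hWle _ _ _ (aux_coupling_swap hπ)
    rw [integral_map measurable_swap.aemeasurable hmeasL.aestronglyMeasurable] at h2
    have i1 : Integrable (fun p : Vec d × Vec d => spoLoss wstar p.1 p.2) π := by
      refine Integrable.of_bound hmeasL.aestronglyMeasurable (C * Metric.diam S) ?_
      filter_upwards [hae] with p hp using hbd _ _ hp.2
    have i2 : Integrable (fun p : Vec d × Vec d => spoLoss wstar p.swap.1 p.swap.2) π := by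
      refine Integrable.of_bound (hmeasL.comp measurable_swap).aestronglyMeasurable
        (C * Metric.diam S) ?_
      filter_upwards [hae] with p hp using hbd _ _ hp.1
    have i3 : Integrable (fun p : Vec d × Vec d => ‖p.1 - p.2‖) π := by
      refine Integrable.of_bound (by fun_prop) (Metric.diam 𝒴) ?_
      filter_upwards [hae] with p hp
      rw [norm_norm, ← dist_eq_norm]
      exact Metric.dist_le_diam_of_mem h𝒴 hp.1 hp.2
    refine (add_le_add h1 h2).trans ?_
    rw [← integral_add i1 i2, ← integral_const_mul]
    refine integral_mono (i1.add i2) (i3.const_mul _) fun p => ?_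
    have e : spoLoss wstar p.1 p.2 + spoLoss wstar p.swap.1 p.swap.2
        = ⟪wstar p.2 - wstar p.1, p.1 - p.2⟫ := by
      simp only [spoLoss, Prod.fst_swap, Prod.snd_swap, inner_sub_left, inner_sub_right,
        real_inner_comm (wstar p.1), real_inner_comm (wstar p.2)]
      ring
    show spoLoss wstar p.1 p.2 + spoLoss wstar p.swap.1 p.swap.2 ≤ _
    rw [e]
    refine (real_inner_le_norm _ _).trans (mul_le_mul_of_nonneg_right ?_ (norm_nonneg _))
    rw [← dist_eq_norm]
    exact Metric.dist_le_diam_of_mem hSb (hwS _) (hwS _)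
  have hD : 0 ≤ Metric.diam S := Metric.diam_nonneg
  have hsym : WDFO wstar μ ν + WDFO wstar ν μ ≤ Metric.diam S * W1 μ ν := by
    rcases hD.eq_or_lt with h0 | hpos
    · have := key _ (aux_coupling_prod μ ν)
      rw [← h0, zero_mul] at this ⊢
      exact this
    · rw [← div_le_iff₀' hpos]
      refine le_csInf ⟨_, _, aux_coupling_prod μ ν, rfl⟩ ?_
      rintro _ ⟨π, hπ, rfl⟩
      rw [div_le_iff₀' hpos]
      exact key π hπ
  have hW1 := aux_W1_le 𝒴 h𝒴 μ ν hμsupp hνsupp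
  have h3 : Metric.diam S * W1 μ ν ≤ Metric.diam S * Metric.diam 𝒴 * tvDist μ ν := by
    rw [mul_assoc]; exact mul_le_mul_of_nonneg_left hW1 hD
  refine ⟨by linarith [hW0 ν μ], hsym, h3, fun hkl => ?_⟩
  refine hsym.trans (h3.trans ?_)
  exact mul_le_mul_of_nonneg_left (aux_tv_pinsker μ ν hkl)
    (mul_nonneg hD Metric.diam_nonneg)
end
end

section
/- Suppose ν has finite second moment and set V² := ∫ ‖y‖₂² dν(y). Then W^O_DF(μ,ν) ≤ V · W₂(w*_#μ, w*_#ν). Moreover, W^O_DF(μ,ν) ≤ V · D_W · √(d_TV(w*_#μ, w*_#ν)) ≤ V · D_W · (KL(w*_#μ ‖ w*_#ν)/2)^{1/4} whenever the KL divergence is finite. -/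
open MeasureTheory Set
open scoped RealInnerProductSpace ENNReal

noncomputable section

/-- The squared quadratic Wasserstein distance `W₂²(P,Q) = inf_{π ∈ Γ(P,Q)} ∫ ‖x−y‖² dπ`. -/
def W2sq {d : ℕ} (P Q : Measure (Vec d)) : ℝ :=
  sInf {r | ∃ π : Measure (Vec d × Vec d), IsCoupling P Q π ∧
    r = ∫ p, ‖p.1 - p.2‖ ^ 2 ∂π}

/-- The quadratic Wasserstein distance `W₂(P,Q)`. -/
def W2 {d : ℕ} (P Q : Measure (Vec d)) : ℝ := Real.sqrt (W2sq P Q)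

lemma bin_pinsker_aux {p q : ℝ} (hp : 0 ≤ p) (hpq : p ≤ q) (hq : q < 1) :
    2 * (p - q) ^ 2 ≤ p * Real.log p - p * Real.log q
      + ((1 - p) * Real.log (1 - p) - (1 - p) * Real.log (1 - q)) := by
  have hmono : MonotoneOn (fun x => - p * Real.log x - (1 - p) * Real.log (1 - x)
      - 2 * (x - p) ^ 2) (Icc p q) := by
    apply monotoneOn_of_deriv_nonneg (convex_Icc p q)
    · apply ContinuousOn.sub
      · apply ContinuousOn.sub
        · rcases hp.eq_or_lt with h | h
          · subst h; simp; exact continuousOn_const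
          · apply ContinuousOn.mul continuousOn_const
            apply ContinuousOn.log continuousOn_id
            intro x hx; simp at hx ⊢; linarith
        · apply ContinuousOn.mul continuousOn_const
          apply ContinuousOn.log (by fun_prop)
          intro x hx; simp at hx ⊢; linarith
      · fun_prop
    · intro x hx
      rw [interior_Icc] at hx
      have h0 : x ≠ 0 := by have := hx.1; linarith
      have h1 : 1 - x ≠ 0 := by have := hx.2; linarith
      apply DifferentiableAt.differentiableWithinAt
      fun_prop (disch := assumption)
    · intro x hx
      rw [interior_Icc] at hx
      have h0 : 0 < x := by have := hx.1; linarith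
      have h1 : 0 < 1 - x := by have := hx.2; linarith
      have hd : HasDerivAt (fun x => - p * Real.log x - (1 - p) * Real.log (1 - x)
          - 2 * (x - p) ^ 2)
          (-p * x⁻¹ - (1 - p) * (-1 / (1 - x)) - 2 * (2 * (x - p) ^ 1 * 1)) x := by
        apply HasDerivAt.sub
        · apply HasDerivAt.sub
          · exact (Real.hasDerivAt_log h0.ne').const_mul _
          · apply HasDerivAt.const_mul
            apply HasDerivAt.log _ h1.ne'
            exact (hasDerivAt_id x).const_sub 1
        · apply HasDerivAt.const_mul
          have := ((hasDerivAt_id x).sub_const p).pow 2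
          convert this using 1 <;> simp [funext_iff]
      rw [hd.deriv]
      have : (-p * x⁻¹ - (1 - p) * (-1 / (1 - x)) - 2 * (2 * (x - p) ^ 1 * 1))
          = (x - p) * (1 - 2 * x) ^ 2 / (x * (1 - x)) := by
        field_simp; ring
      rw [this]
      have := hx.1
      have : 0 ≤ x - p := by linarith
      positivity
  have := hmono (left_mem_Icc.2 hpq) (right_mem_Icc.2 hpq) hpq
  simp only at this
  nlinarith [this]

lemma bin_pinsker {p q : ℝ} (hp : 0 ≤ p) (hp1 : p ≤ 1) (hq : 0 < q) (hq1 : q < 1) :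
    2 * (p - q) ^ 2 ≤ p * Real.log p - p * Real.log q
      + ((1 - p) * Real.log (1 - p) - (1 - p) * Real.log (1 - q)) := by
  rcases le_total p q with h | h
  · exact bin_pinsker_aux hp h hq1
  · have := bin_pinsker_aux (p := 1 - p) (q := 1 - q) (by linarith) (by linarith) (by linarith)
    simp only [sub_sub_cancel] at this
    nlinarith [this]

open InformationTheory in
lemma pinsker_bool (P Q : Measure Bool) [IsProbabilityMeasure P] [IsProbabilityMeasure Q]
    (h : P ≪ Q) :
    2 * (P.real {true} - Q.real {true}) ^ 2 ≤ (klDiv P Q).toReal := by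
  rw [toReal_klDiv_eq_integral_klFun h, integral_fintype (Integrable.of_finite)]
  have key : ∀ b, Q.real {b} • klFun (P.rnDeriv Q b).toReal =
      P.real {b} * Real.log (P.real {b}) - P.real {b} * Real.log (Q.real {b})
        + Q.real {b} - P.real {b} := by
    intro b
    have e : P.real {b} = (P.rnDeriv Q b).toReal * Q.real {b} := by
      have := Measure.withDensity_rnDeriv_eq P Q h
      conv_lhs => rw [← this]
      rw [measureReal_def, withDensity_apply _ (measurableSet_singleton b), lintegral_singleton,
        ENNReal.toReal_mul, measureReal_def]
    rw [klFun, e, smul_eq_mul]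
    by_cases hq : Q.real {b} = 0
    · rw [hq]; simp
    by_cases hr : (P.rnDeriv Q b).toReal = 0
    · rw [hr]; simp
    rw [Real.log_mul hr hq]; ring
  simp_rw [key]
  have hPs : P.real {false} = 1 - P.real {true} := by
    rw [← probReal_compl_eq_one_sub (measurableSet_singleton _)]; congr 1; ext b; cases b <;> simp
  have hQs : Q.real {false} = 1 - Q.real {true} := by
    rw [← probReal_compl_eq_one_sub (measurableSet_singleton _)]; congr 1; ext b; cases b <;> simp
  have hac : ∀ b, Q.real {b} = 0 → P.real {b} = 0 := by
    intro b hb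
    rw [measureReal_eq_zero_iff] at hb ⊢
    exact h hb
  simp only [Fintype.sum_bool, hPs, hQs]
  have h1 := hac true
  have h2 := hac false
  rw [hPs, hQs] at h2
  have p0 : 0 ≤ P.real {true} := measureReal_nonneg
  have q0 : 0 ≤ Q.real {true} := measureReal_nonneg
  have p1 : P.real {true} ≤ 1 := measureReal_le_one
  have q1 : Q.real {true} ≤ 1 := measureReal_le_one
  generalize P.real {true} = p at *
  generalize Q.real {true} = q at *
  rcases q0.eq_or_lt with hq | hq
  · have := h1 hq.symm; subst this; subst hq; simp
  rcases q1.eq_or_lt with hq1 | hq1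
  · have := h2 (by linarith)
    have : p = 1 := by linarith
    subst this; subst hq1; simp
  have := bin_pinsker p0 p1 hq hq1
  linarith

open InformationTheory in
open Classical in
lemma pinsker_set {α : Type*} [MeasurableSpace α] (P Q : Measure α) [IsProbabilityMeasure P]
    [IsProbabilityMeasure Q] (h : KLFinite P Q) {A : Set α} (hA : MeasurableSet A) :
    2 * (P.real A - Q.real A) ^ 2 ≤ klDivReal P Q := by
  have hg : Measurable (fun x => decide (x ∈ A)) := measurable_to_bool (by
    convert hA using 1; ext; simp)
  have hpre : (fun x => decide (x ∈ A)) ⁻¹' {true} = A := by ext; simp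
  have : IsProbabilityMeasure (P.map (fun x => decide (x ∈ A))) :=
    Measure.isProbabilityMeasure_map hg.aemeasurable
  have : IsProbabilityMeasure (Q.map (fun x => decide (x ∈ A))) :=
    Measure.isProbabilityMeasure_map hg.aemeasurable
  have h1 := pinsker_bool _ _ (h.1.map hg)
  rw [map_measureReal_apply hg (measurableSet_singleton _),
    map_measureReal_apply hg (measurableSet_singleton _), hpre] at h1
  rw [klDivReal, ← toReal_klDiv_of_measure_eq h.1 (by simp)]
  exact h1.trans (ENNReal.toReal_mono (klDiv_ne_top h.1 h.2) (klDiv_map_le P Q hg))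

lemma tv_le {α : Type*} [MeasurableSpace α] (P Q : Measure α) [IsProbabilityMeasure P]
    [IsProbabilityMeasure Q] (h : KLFinite P Q) :
    Real.sqrt (tvDist P Q) ≤ (klDivReal P Q / 2) ^ ((1 : ℝ) / 4) := by
  have h0 : 0 ≤ klDivReal P Q := by
    have := pinsker_set P Q h MeasurableSet.univ
    simpa using this
  have h1 : tvDist P Q ≤ Real.sqrt (klDivReal P Q / 2) := by
    have : Nonempty {A : Set α // MeasurableSet A} := ⟨⟨_, MeasurableSet.univ⟩⟩
    apply ciSup_le
    intro A
    apply Real.abs_le_sqrt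
    have := pinsker_set P Q h A.2
    simp only [measureReal_def] at this
    linarith
  refine (Real.sqrt_le_sqrt h1).trans (le_of_eq ?_)
  rw [Real.sqrt_eq_rpow, Real.sqrt_eq_rpow, ← Real.rpow_mul (by linarith)]
  norm_num

lemma glue_fst {α β α' β' : Type*} [MeasurableSpace α] [MeasurableSpace β]
    [MeasurableSpace α'] [MeasurableSpace β'] (μ : Measure α) (ν : Measure β)
    [IsProbabilityMeasure μ] [IsProbabilityMeasure ν] (f : α → α') (g : β → β')
    (hf : Measurable f) (hg : Measurable g) (k : α' × β' → ℝ≥0∞) (hk : Measurable k)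
    (h1 : (((μ.map f).prod (ν.map g)).withDensity k).map Prod.fst = μ.map f) :
    ((μ.prod ν).withDensity (k ∘ Prod.map f g)).map Prod.fst = μ := by
  have : IsProbabilityMeasure (μ.map f) := Measure.isProbabilityMeasure_map hf.aemeasurable
  have : IsProbabilityMeasure (ν.map g) := Measure.isProbabilityMeasure_map hg.aemeasurable
  set P := μ.map f with hP
  set Q := ν.map g with hQ
  have hH : Measurable (fun a => ∫⁻ b, k (a, b) ∂Q) := hk.lintegral_prod_right'
  have e1 : P.withDensity (fun a => ∫⁻ b, k (a, b) ∂Q) = P := by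
    conv_rhs => rw [← h1]
    ext s hs
    rw [withDensity_apply _ hs, Measure.map_apply measurable_fst hs,
      withDensity_apply _ (measurable_fst hs), ← Set.prod_univ,
      setLIntegral_prod _ hk.aemeasurable]
    simp
  have e2 : (fun a => ∫⁻ b, k (a, b) ∂Q) =ᵐ[P] fun _ => 1 := by
    rw [← withDensity_eq_iff_of_sigmaFinite hH.aemeasurable aemeasurable_const]
    rw [e1]; exact (withDensity_one).symm
  have e3 : ∀ᵐ x ∂μ, ∫⁻ b, k (f x, b) ∂Q = 1 := ae_of_ae_map hf.aemeasurable e2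
  ext s hs
  rw [Measure.map_apply measurable_fst hs,
      withDensity_apply _ (measurable_fst hs), ← Set.prod_univ,
      setLIntegral_prod _ (hk.comp (hf.prodMap hg)).aemeasurable]
  simp only [Measure.restrict_univ]
  have e4 : ∀ x, ∫⁻ y, (k ∘ Prod.map f g) (x, y) ∂ν = ∫⁻ b, k (f x, b) ∂Q := by
    intro x
    rw [hQ, lintegral_map (by fun_prop) hg]; rfl
  simp_rw [e4]
  rw [lintegral_congr_ae (ae_restrict_of_ae e3)]
  simp

lemma wd_swap {γ δ : Type*} [MeasurableSpace γ] [MeasurableSpace δ] (M : Measure γ)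
    (N : Measure δ) [IsProbabilityMeasure M] [IsProbabilityMeasure N] (k : γ × δ → ℝ≥0∞)
    (hk : Measurable k) : ((M.prod N).withDensity k).map Prod.snd
        = ((N.prod M).withDensity (k ∘ Prod.swap)).map Prod.fst := by
  ext s hs
  rw [Measure.map_apply measurable_fst hs, withDensity_apply _ (measurable_fst hs),
    Measure.map_apply measurable_snd hs, withDensity_apply _ (measurable_snd hs),
    ← Measure.prod_swap, setLIntegral_map (measurable_snd hs) hk measurable_swap]
  rfl

lemma glue_snd {α β α' β' : Type*} [MeasurableSpace α] [MeasurableSpace β]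
    [MeasurableSpace α'] [MeasurableSpace β'] (μ : Measure α) (ν : Measure β)
    [IsProbabilityMeasure μ] [IsProbabilityMeasure ν] (f : α → α') (g : β → β')
    (hf : Measurable f) (hg : Measurable g) (k : α' × β' → ℝ≥0∞) (hk : Measurable k)
    (h1 : (((μ.map f).prod (ν.map g)).withDensity k).map Prod.snd = ν.map g) :
    ((μ.prod ν).withDensity (k ∘ Prod.map f g)).map Prod.snd = ν := by
  have : IsProbabilityMeasure (μ.map f) := Measure.isProbabilityMeasure_map hf.aemeasurable
  have : IsProbabilityMeasure (ν.map g) := Measure.isProbabilityMeasure_map hg.aemeasurable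
  rw [wd_swap _ _ _ hk] at h1
  rw [wd_swap μ ν (k ∘ Prod.map f g) (hk.comp (hf.prodMap hg))]
  have e : (k ∘ Prod.map f g) ∘ Prod.swap = (k ∘ Prod.swap) ∘ Prod.map g f := by
    ext ⟨x, y⟩; rfl
  rw [e]
  exact glue_fst ν μ g f hg hf (k ∘ Prod.swap) (hk.comp measurable_swap) h1

lemma coupling_mem {d : ℕ} (𝔖 : Finset (Vec d)) (w : Vec d → Vec d) (hw : Measurable w)
    (hmem : ∀ x, w x ∈ 𝔖) (μ ν : Measure (Vec d)) (π : Measure (Vec d × Vec d))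
    (hπ : IsCoupling (μ.map w) (ν.map w) π) :
    (∀ᵐ p ∂π, p.1 ∈ 𝔖) ∧ (∀ᵐ p ∂π, p.2 ∈ 𝔖) := by
  have hm : MeasurableSet {x | x ∈ 𝔖} := Finset.measurableSet 𝔖
  constructor
  · apply ae_of_ae_map (p := fun x => x ∈ 𝔖) measurable_fst.aemeasurable
    rw [hπ.1, ae_map_iff hw.aemeasurable hm]
    exact ae_of_all _ hmem
  · apply ae_of_ae_map (p := fun x => x ∈ 𝔖) measurable_snd.aemeasurable
    rw [hπ.2, ae_map_iff hw.aemeasurable hm]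
    exact ae_of_all _ hmem

lemma exists_glue {d : ℕ} (𝔖 : Finset (Vec d)) (w : Vec d → Vec d) (hw : Measurable w)
    (hmem : ∀ x, w x ∈ 𝔖) (μ ν : Measure (Vec d)) [IsProbabilityMeasure μ]
    [IsProbabilityMeasure ν] (π : Measure (Vec d × Vec d))
    (hπ : IsCoupling (μ.map w) (ν.map w) π) :
    ∃ γ : Measure (Vec d × Vec d), IsCoupling μ ν γ ∧ γ.map (Prod.map w w) = π := by
  have : IsProbabilityMeasure (μ.map w) := Measure.isProbabilityMeasure_map hw.aemeasurable
  have : IsProbabilityMeasure (ν.map w) := Measure.isProbabilityMeasure_map hw.aemeasurable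
  have hprob : IsProbabilityMeasure π := by
    refine ⟨?_⟩
    have := measure_univ (μ := μ.map w)
    rw [← hπ.1, Measure.map_apply measurable_fst MeasurableSet.univ] at this
    simpa using this
  obtain ⟨s1, s2⟩ := coupling_mem 𝔖 w hw hmem μ ν π hπ
  have hac : π ≪ (μ.map w).prod (ν.map w) := by
    intro s hs
    have hsub : ∀ᵐ p ∂π, p ∈ ((𝔖 ×ˢ 𝔖 : Finset _) : Set (Vec d × Vec d)) := by
      filter_upwards [s1, s2] with p h1 h2
      simp [h1, h2]
    have : π s ≤ π (⋃ p ∈ {p ∈ (((𝔖 ×ˢ 𝔖 : Finset _) : Set (Vec d × Vec d))) | p ∈ s}, {p}) := by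
      apply measure_mono_ae
      filter_upwards [hsub] with p hp hps
      exact Set.mem_biUnion (x := p) ⟨hp, hps⟩ rfl
    refine le_antisymm (this.trans (le_of_eq ?_)) bot_le
    rw [measure_biUnion_null_iff (((Finset.finite_toSet _).subset (Set.sep_subset _ _)).countable)]
    rintro ⟨a, b⟩ ⟨-, hp⟩
    have h0 : (μ.map w).prod (ν.map w) {(a, b)} = 0 :=
      measure_mono_null (Set.singleton_subset_iff.2 hp) hs
    rw [← Set.singleton_prod_singleton, Measure.prod_prod, mul_eq_zero] at h0
    rcases h0 with h0 | h0
    · rw [← hπ.1, Measure.map_apply measurable_fst (measurableSet_singleton _)] at h0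
      exact measure_mono_null (by rintro _ rfl; simp) h0
    · rw [← hπ.2, Measure.map_apply measurable_snd (measurableSet_singleton _)] at h0
      exact measure_mono_null (by rintro _ rfl; simp) h0
  set k := π.rnDeriv ((μ.map w).prod (ν.map w)) with hkdef
  have hk : Measurable k := Measure.measurable_rnDeriv _ _
  have hπk : ((μ.map w).prod (ν.map w)).withDensity k = π := Measure.withDensity_rnDeriv_eq _ _ hac
  refine ⟨(μ.prod ν).withDensity (k ∘ Prod.map w w), ⟨?_, ?_⟩, ?_⟩
  · apply glue_fst _ _ _ _ hw hw k hk; rw [hπk]; exact hπ.1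
  · apply glue_snd _ _ _ _ hw hw k hk; rw [hπk]; exact hπ.2
  · rw [← hπk]
    ext s hs
    have hww : Measurable (Prod.map w w) := hw.prodMap hw
    rw [Measure.map_apply hww hs, withDensity_apply _ (hww hs), withDensity_apply _ hs,
      Measure.map_prod_map _ _ hw hw, setLIntegral_map hs hk hww]
    rfl

lemma exists_max_coupling {d : ℕ} (P Q : Measure (Vec d)) [IsProbabilityMeasure P]
    [IsProbabilityMeasure Q] :
    ∃ π : Measure (Vec d × Vec d), IsCoupling P Q π ∧
      π.real {p | p.1 ≠ p.2} ≤ tvDist P Q := by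
  obtain ⟨s, hs, h1, h2⟩ := hahn_decomposition P Q
  have hle1 : Q.restrict s ≤ P.restrict s := by
    rw [Measure.le_iff]
    intro t ht
    rw [Measure.restrict_apply ht, Measure.restrict_apply ht]
    exact h1 _ (ht.inter hs) inter_subset_right
  have hle2 : P.restrict sᶜ ≤ Q.restrict sᶜ := by
    rw [Measure.le_iff]
    intro t ht
    rw [Measure.restrict_apply ht, Measure.restrict_apply ht]
    exact h2 _ (ht.inter hs.compl) inter_subset_right
  set R1 := P.restrict s - Q.restrict s with hR1
  set R2 := Q.restrict sᶜ - P.restrict sᶜ with hR2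
  set m := Q.restrict s + P.restrict sᶜ with hm
  have eP : m + R1 = P := by
    have := Measure.sub_add_cancel_of_le hle1
    rw [hm, add_right_comm, add_comm (Q.restrict s), this, Measure.restrict_add_restrict_compl hs]
  have eQ : m + R2 = Q := by
    have := Measure.sub_add_cancel_of_le hle2
    rw [hm, add_assoc, add_comm (P.restrict sᶜ), this, Measure.restrict_add_restrict_compl hs]
  have hR1u : R1 univ = P s - Q s := by
    rw [hR1, Measure.sub_apply MeasurableSet.univ hle1]; simp
  have hR : R1 univ = R2 univ := by
    have a : m univ + R1 univ = m univ + R2 univ := by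
      rw [← Measure.add_apply, ← Measure.add_apply, eP, eQ]; simp
    exact (ENNReal.add_right_inj (measure_ne_top m _)).1 a
  set t := R1 univ with ht
  have httop : t ≠ ∞ := measure_ne_top _ _
  have hdiag : Measurable (fun x : Vec d => (x, x)) := by fun_prop
  have hne : MeasurableSet {p : Vec d × Vec d | p.1 ≠ p.2} :=
    (measurableSet_eq_fun measurable_fst measurable_snd).compl
  refine ⟨m.map (fun x => (x, x)) + t⁻¹ • R1.prod R2, ⟨?_, ?_⟩, ?_⟩
  · rw [Measure.map_add _ _ measurable_fst, Measure.map_smul, Measure.map_fst_prod,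
      Measure.map_map measurable_fst hdiag]
    conv_rhs => rw [← eP]
    congr 1
    · exact Measure.map_id
    · by_cases h0 : t = 0
      · have : R1 = 0 := Measure.measure_univ_eq_zero.1 h0
        simp [this]
      · rw [← hR, smul_smul, ENNReal.inv_mul_cancel h0 httop, one_smul]
  · rw [Measure.map_add _ _ measurable_snd, Measure.map_smul, Measure.map_snd_prod,
      Measure.map_map measurable_snd hdiag]
    conv_rhs => rw [← eQ]
    congr 1
    · exact Measure.map_id
    · by_cases h0 : t = 0
      · have : R2 = 0 := Measure.measure_univ_eq_zero.1 (hR ▸ h0)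
        simp [this]
      · rw [← ht, smul_smul, ENNReal.inv_mul_cancel h0 httop, one_smul]
  · have hb : (m.map (fun x => (x, x)) + t⁻¹ • R1.prod R2) {p | p.1 ≠ p.2} ≤ t := by
      rw [Measure.add_apply, Measure.map_apply hdiag hne, Measure.smul_apply, smul_eq_mul]
      have : (fun x : Vec d => (x, x)) ⁻¹' {p | p.1 ≠ p.2} = ∅ := by ext; simp
      rw [this, measure_empty, zero_add]
      calc t⁻¹ * (R1.prod R2) {p | p.1 ≠ p.2} ≤ t⁻¹ * (R1.prod R2) univ := by
            gcongr; exact subset_univ _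
        _ = t⁻¹ * (t * t) := by rw [← univ_prod_univ, Measure.prod_prod, ← hR]
        _ ≤ t := by
          rw [← mul_assoc]
          exact mul_le_of_le_one_left bot_le (ENNReal.inv_mul_le_one _)
    have hb2 := ENNReal.toReal_mono httop hb
    refine hb2.trans ?_
    rw [hR1u, ENNReal.toReal_sub_of_le (h1 s hs subset_rfl) (measure_ne_top _ _)]
    refine (le_abs_self _).trans ?_
    refine le_ciSup (f := fun A : {A : Set (Vec d) // MeasurableSet A} =>
      |(P A.1).toReal - (Q A.1).toReal|) ⟨1, ?_⟩ ⟨s, hs⟩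
    rintro _ ⟨A, rfl⟩
    have a1 : P.real A.1 ≤ 1 := measureReal_le_one
    have a2 : Q.real A.1 ≤ 1 := measureReal_le_one
    have a3 : 0 ≤ P.real A.1 := measureReal_nonneg
    have a4 : 0 ≤ Q.real A.1 := measureReal_nonneg
    simp only [measureReal_def] at a1 a2 a3 a4
    simp only
    rw [abs_le]; constructor <;> linarith

lemma coupling_prob {d : ℕ} {P Q : Measure (Vec d)} [IsProbabilityMeasure P]
    {π : Measure (Vec d × Vec d)} (hπ : IsCoupling P Q π) : IsProbabilityMeasure π := by
  refine ⟨?_⟩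
  have := measure_univ (μ := P)
  rw [← hπ.1, Measure.map_apply measurable_fst MeasurableSet.univ] at this
  simpa using this

lemma W2sq_bdd {d : ℕ} (P Q : Measure (Vec d)) :
    BddBelow {r | ∃ π : Measure (Vec d × Vec d), IsCoupling P Q π ∧
    r = ∫ p, ‖p.1 - p.2‖ ^ 2 ∂π} := by
  refine ⟨0, ?_⟩
  rintro _ ⟨π, -, rfl⟩
  exact integral_nonneg fun _ => by positivity

lemma W2sq_le {d : ℕ} (S : Set (Vec d)) (hS : Bornology.IsBounded S) (P Q : Measure (Vec d))
    [IsProbabilityMeasure P] [IsProbabilityMeasure Q]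
    (hsupp : ∀ π, IsCoupling P Q π → ∀ᵐ p ∂π, p.1 ∈ S ∧ p.2 ∈ S) :
    W2sq P Q ≤ Metric.diam S ^ 2 * tvDist P Q := by
  obtain ⟨π, hπ, htv⟩ := exists_max_coupling P Q
  have := coupling_prob hπ
  have hne : MeasurableSet {p : Vec d × Vec d | p.1 ≠ p.2} :=
    (measurableSet_eq_fun measurable_fst measurable_snd).compl
  refine (csInf_le (W2sq_bdd P Q) ⟨π, hπ, rfl⟩).trans ?_
  calc ∫ p, ‖p.1 - p.2‖ ^ 2 ∂π
      ≤ ∫ p, {p : Vec d × Vec d | p.1 ≠ p.2}.indicator (fun _ => Metric.diam S ^ 2) p ∂π := by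
        apply integral_mono_of_nonneg
        · exact ae_of_all _ fun _ => by positivity
        · exact (integrable_const _).indicator hne
        · filter_upwards [hsupp π hπ] with p hp
          by_cases h : p.1 = p.2
          · simp [h]
          · rw [indicator_of_mem (by exact h)]
            gcongr
            rw [← dist_eq_norm]
            exact Metric.dist_le_diam_of_mem hS hp.1 hp.2
    _ = Metric.diam S ^ 2 * π.real {p | p.1 ≠ p.2} := by
        rw [integral_indicator_const _ hne, smul_eq_mul, mul_comm]
    _ ≤ _ := by gcongr

lemma WDFO_le_of_coupling {d : ℕ} (S : Set (Vec d)) (hS : Bornology.IsBounded S)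
    (w : Vec d → Vec d) (hw : Measurable w) (hmem : ∀ x, w x ∈ S)
    (hwopt : ∀ x : Vec d, ∀ a ∈ S, ⟪w x, x⟫ ≤ ⟪a, x⟫)
    (μ ν : Measure (Vec d)) [IsProbabilityMeasure μ] [IsProbabilityMeasure ν]
    (hν2 : Integrable (fun y : Vec d => ‖y‖ ^ 2) ν) (γ : Measure (Vec d × Vec d))
    (hγ : IsCoupling μ ν γ) :
    WDFO w μ ν ≤ Real.sqrt (∫ y, ‖y‖ ^ 2 ∂ν) *
      Real.sqrt (∫ p, ‖p.1 - p.2‖ ^ 2 ∂(γ.map (Prod.map w w))) := by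
  have := coupling_prob hγ
  have hnn : ∀ x y, 0 ≤ spoLoss w x y := by
    intro x y
    have := hwopt y (w x) (hmem x)
    rw [spoLoss, real_inner_comm, real_inner_comm y]
    simpa [real_inner_comm] using this
  have hww : Measurable (Prod.map w w) := hw.prodMap hw
  have hw1 : Measurable (fun p : Vec d × Vec d => w p.1) := hw.comp measurable_fst
  have hw2 : Measurable (fun p : Vec d × Vec d => w p.2) := hw.comp measurable_snd
  have hbdd : BddBelow {r | ∃ γ : Measure (Vec d × Vec d), IsCoupling μ ν γ ∧
      r = ∫ p, spoLoss w p.1 p.2 ∂γ} := by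
    refine ⟨0, ?_⟩
    rintro _ ⟨π, -, rfl⟩
    exact integral_nonneg fun _ => hnn _ _
  refine (csInf_le hbdd ⟨γ, hγ, rfl⟩).trans ?_
  have eI : ∫ y, ‖y‖ ^ 2 ∂ν = ∫ p, ‖p.2‖ ^ 2 ∂γ := by
    rw [← hγ.2, integral_map measurable_snd.aemeasurable (by fun_prop)]
  have eJ : ∫ p, ‖p.1 - p.2‖ ^ 2 ∂(γ.map (Prod.map w w)) = ∫ p, ‖w p.1 - w p.2‖ ^ 2 ∂γ := by
    rw [integral_map hww.aemeasurable (by fun_prop)]; rfl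
  have hf : MemLp (fun p : Vec d × Vec d => ‖p.2‖) 2 γ := by
    rw [memLp_two_iff_integrable_sq (by fun_prop)]
    have : Integrable (fun y : Vec d => ‖y‖ ^ 2) (γ.map Prod.snd) := by rw [hγ.2]; exact hν2
    exact this.comp_measurable measurable_snd
  have hg : MemLp (fun p : Vec d × Vec d => ‖w p.1 - w p.2‖) 2 γ := by
    apply MemLp.of_bound (by fun_prop) (Metric.diam S)
    refine ae_of_all _ fun p => ?_
    rw [norm_norm, ← dist_eq_norm]
    exact Metric.dist_le_diam_of_mem hS (hmem _) (hmem _)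
  rw [eI, eJ]
  calc ∫ p, spoLoss w p.1 p.2 ∂γ ≤ ∫ p, ‖p.2‖ * ‖w p.1 - w p.2‖ ∂γ := by
        apply integral_mono_of_nonneg
        · exact ae_of_all _ fun _ => hnn _ _
        · exact hf.integrable_mul hg
        · refine ae_of_all _ fun p => ?_
          simp only [spoLoss]
          rw [← inner_sub_right]
          exact real_inner_le_norm _ _
    _ ≤ _ := by
      have := integral_mul_le_Lp_mul_Lq_of_nonneg (μ := γ) Real.HolderConjugate.two_two
        (f := fun p : Vec d × Vec d => ‖p.2‖) (g := fun p => ‖w p.1 - w p.2‖)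
        (ae_of_all _ fun _ => norm_nonneg _) (ae_of_all _ fun _ => norm_nonneg _)
        (by simpa using hf) (by simpa using hg)
      simpa [Real.sqrt_eq_rpow] using this

/-- **The optimistic DF distance is Lipschitz with respect to the `W₂` distance between
oracle push-forwards.** With `V² = ∫ ‖y‖² dν`:
`W^O_DF(μ,ν) ≤ V·W₂(w*_#μ, w*_#ν)`, moreover
`W^O_DF(μ,ν) ≤ V·D_W·√(d_TV(w*_#μ, w*_#ν))`, and whenever `KL(w*_#μ‖w*_#ν) < ∞` the latter
bound is itself at most `V·D_W·(KL(w*_#μ‖w*_#ν)/2)^{1/4}`. -/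
theorem stmt2 {d : ℕ} (S : Set (Vec d)) (𝔖 : Finset (Vec d)) (wstar : Vec d → Vec d)
    (hSne : S.Nonempty) (hScomp : IsCompact S)
    (hext : (𝔖 : Set (Vec d)) = S.extremePoints ℝ)
    (hwmeas : Measurable wstar) (hwmem : ∀ x, wstar x ∈ 𝔖)
    (hwopt : ∀ x : Vec d, ∀ w ∈ S, ⟪wstar x, x⟫ ≤ ⟪w, x⟫)
    (μ ν : Measure (Vec d)) [IsProbabilityMeasure μ] [IsProbabilityMeasure ν]
    (hν2 : Integrable (fun y : Vec d => ‖y‖ ^ 2) ν) :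
    WDFO wstar μ ν ≤
      Real.sqrt (∫ y, ‖y‖ ^ 2 ∂ν) * W2 (μ.map wstar) (ν.map wstar) ∧
    WDFO wstar μ ν ≤
      Real.sqrt (∫ y, ‖y‖ ^ 2 ∂ν) * Metric.diam S *
        Real.sqrt (tvDist (μ.map wstar) (ν.map wstar)) ∧
    (KLFinite (μ.map wstar) (ν.map wstar) →
      Real.sqrt (∫ y, ‖y‖ ^ 2 ∂ν) * Metric.diam S *
          Real.sqrt (tvDist (μ.map wstar) (ν.map wstar)) ≤
        Real.sqrt (∫ y, ‖y‖ ^ 2 ∂ν) * Metric.diam S *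
          (klDivReal (μ.map wstar) (ν.map wstar) / 2) ^ ((1 : ℝ) / 4)) := by
  have hmemS : ∀ x, wstar x ∈ S := fun x => by
    have : wstar x ∈ (𝔖 : Set (Vec d)) := hwmem x
    rw [hext] at this
    exact this.1
  have hS := hScomp.isBounded
  have : IsProbabilityMeasure (μ.map wstar) := Measure.isProbabilityMeasure_map hwmeas.aemeasurable
  have : IsProbabilityMeasure (ν.map wstar) := Measure.isProbabilityMeasure_map hwmeas.aemeasurable
  have hV : 0 ≤ Real.sqrt (∫ y, ‖y‖ ^ 2 ∂ν) := Real.sqrt_nonneg _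
  have hD : 0 ≤ Metric.diam S := Metric.diam_nonneg
  have hsub : ∀ x ∈ 𝔖, x ∈ S := fun x hx => by
    have : x ∈ (𝔖 : Set (Vec d)) := hx
    rw [hext] at this
    exact this.1
  have first : WDFO wstar μ ν ≤
      Real.sqrt (∫ y, ‖y‖ ^ 2 ∂ν) * W2 (μ.map wstar) (ν.map wstar) := by
    have hmono : Monotone (fun r => Real.sqrt (∫ y, ‖y‖ ^ 2 ∂ν) * Real.sqrt r) :=
      fun a b hab => mul_le_mul_of_nonneg_left (Real.sqrt_le_sqrt hab) hV
    have hne : {r | ∃ π : Measure (Vec d × Vec d), IsCoupling (μ.map wstar) (ν.map wstar) π ∧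
        r = ∫ p, ‖p.1 - p.2‖ ^ 2 ∂π}.Nonempty := by
      obtain ⟨π, hπ, -⟩ := exists_max_coupling (μ.map wstar) (ν.map wstar)
      exact ⟨_, π, hπ, rfl⟩
    have key := hmono.map_csInf_of_continuousAt (by fun_prop) hne (W2sq_bdd _ _)
    rw [W2, W2sq]
    refine le_of_le_of_eq ?_ key.symm
    apply le_csInf (hne.image _)
    rintro _ ⟨_, ⟨π, hπ, rfl⟩, rfl⟩
    obtain ⟨γ, hγ, hγπ⟩ := exists_glue 𝔖 wstar hwmeas hwmem μ ν π hπ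
    have := WDFO_le_of_coupling S hS wstar hwmeas hmemS hwopt μ ν hν2 γ hγ
    rwa [hγπ] at this
  refine ⟨first, first.trans ?_, fun hKL => ?_⟩
  · rw [mul_assoc]
    refine mul_le_mul_of_nonneg_left ?_ hV
    rw [W2]
    have h := W2sq_le S hS (μ.map wstar) (ν.map wstar) (fun π hπ => by
      obtain ⟨s1, s2⟩ := coupling_mem 𝔖 wstar hwmeas hwmem μ ν π hπ
      filter_upwards [s1, s2] with p h1 h2 using ⟨hsub _ h1, hsub _ h2⟩)
    refine (Real.sqrt_le_sqrt h).trans (le_of_eq ?_)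
    rw [Real.sqrt_mul (by positivity), Real.sqrt_sq hD]
  · exact mul_le_mul_of_nonneg_left (tv_le _ _ hKL) (mul_nonneg hV hD)
end
end

section
/- Assume μ and ν are probability measures on ℝ^d with finite second moments, and let w̄* := −w*. Then W^O_DF(μ,ν) = (1/2)·[ W₂²((w̄*)_#μ, ν) − ‖w*_#μ‖² − ‖ν‖² ] − ∫ yᵀ w*(y) dν(y), where for any probability measure ρ on ℝ^d we write ‖ρ‖² := ∫ ‖z‖₂² dρ(z). -/
open MeasureTheory Set
open scoped RealInnerProductSpace ENNReal

noncomputable section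

theorem coupling_lift {d : ℕ} (T : Vec d → Vec d) (hT : Measurable T)
    (μ ν : Measure (Vec d)) [IsProbabilityMeasure μ] [IsProbabilityMeasure ν]
    (π : Measure (Vec d × Vec d)) (hπ : IsCoupling (μ.map T) ν π) :
    ∃ γ : Measure (Vec d × Vec d), IsCoupling μ ν γ ∧
      γ.map (fun p => (T p.1, p.2)) = π := by
  obtain ⟨h1, h2⟩ := hπ
  have hP : IsProbabilityMeasure (μ.map T) := Measure.isProbabilityMeasure_map hT.aemeasurable
  have hpi : IsProbabilityMeasure π := by
    rw [← h1] at hP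
    exact Measure.isProbabilityMeasure_of_map Prod.fst
  have hfst : π.fst = μ.map T := h1
  have hm : Measurable (fun p : Vec d × Vec d => (T p.1, p.2)) := by fun_prop
  have key : (μ.compProd (π.condKernel.comap T hT)).map (fun p => (T p.1, p.2)) = π := by
    conv_rhs => rw [← π.disintegrate π.condKernel, hfst]
    ext s hs
    rw [Measure.map_apply hm hs, Measure.compProd_apply (hm hs), Measure.compProd_apply hs,
      lintegral_map (ProbabilityTheory.Kernel.measurable_kernel_prodMk_left hs) hT]
    rfl
  refine ⟨_, ⟨?_, ?_⟩, key⟩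
  · exact Measure.fst_compProd μ _
  · have h3 := congrArg (Measure.map Prod.snd) key
    rw [Measure.map_map measurable_snd hm, h2] at h3
    exact h3

theorem coupling_cost {d : ℕ} (wstar : Vec d → Vec d) (C : ℝ)
    (hwmeas : Measurable wstar) (hC : ∀ x, ‖wstar x‖ ≤ C)
    (μ ν : Measure (Vec d)) [IsProbabilityMeasure μ] [IsProbabilityMeasure ν]
    (hν2 : Integrable (fun y : Vec d => ‖y‖ ^ 2) ν)
    (γ : Measure (Vec d × Vec d)) (hγ : IsCoupling μ ν γ) :
    ∫ p, spoLoss wstar p.1 p.2 ∂γ =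
      (1 / 2) * ((∫ p, ‖-wstar p.1 - p.2‖ ^ 2 ∂γ)
          - (∫ z, ‖z‖ ^ 2 ∂(μ.map wstar)) - ∫ z, ‖z‖ ^ 2 ∂ν)
        - ∫ y, ⟪y, wstar y⟫ ∂ν := by
  obtain ⟨h1, h2⟩ := hγ
  have hpi : IsProbabilityMeasure γ := by
    have : IsProbabilityMeasure (γ.map Prod.fst) := by rw [h1]; infer_instance
    exact Measure.isProbabilityMeasure_of_map Prod.fst
  have hC0 : 0 ≤ C := (norm_nonneg _).trans (hC 0)
  have iy2 : Integrable (fun p : Vec d × Vec d => ‖p.2‖ ^ 2) γ := by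
    rw [← h2] at hν2
    exact hν2.comp_measurable measurable_snd
  have bound : Integrable (fun p : Vec d × Vec d => (1 + ‖p.2‖ ^ 2) * C) γ :=
    ((integrable_const 1).add iy2).mul_const C
  have aux : ∀ y x : Vec d, ‖(⟪y, wstar x⟫ : ℝ)‖ ≤ ‖(1 + ‖y‖ ^ 2) * C‖ := by
    intro y x
    rw [Real.norm_of_nonneg (by positivity : 0 ≤ (1 + ‖y‖ ^ 2) * C)]
    refine (norm_inner_le_norm y (wstar x)).trans ?_
    have := hC x
    gcongr
    nlinarith [sq_nonneg (‖y‖ - 1), sq_nonneg ‖y‖]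
  have i1 : Integrable (fun p : Vec d × Vec d => (⟪p.2, wstar p.1⟫ : ℝ)) γ :=
    bound.mono (by fun_prop) (.of_forall fun p => aux _ _)
  have i2 : Integrable (fun p : Vec d × Vec d => (⟪p.2, wstar p.2⟫ : ℝ)) γ :=
    bound.mono (by fun_prop) (.of_forall fun p => aux _ _)
  have iw2 : Integrable (fun p : Vec d × Vec d => ‖wstar p.1‖ ^ 2) γ := by
    refine (integrable_const (C ^ 2)).mono'
      ((hwmeas.comp measurable_fst).norm.pow_const 2).aestronglyMeasurable (.of_forall fun p => ?_)
    rw [Real.norm_of_nonneg (by positivity)]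
    have := hC p.1
    gcongr
  have e1 : ∫ z, ‖z‖ ^ 2 ∂(μ.map wstar) = ∫ p, ‖wstar p.1‖ ^ 2 ∂γ := by
    rw [← h1, Measure.map_map hwmeas measurable_fst,
      integral_map (hwmeas.comp measurable_fst).aemeasurable (by fun_prop)]
    rfl
  have e2 : ∫ z, ‖z‖ ^ 2 ∂ν = ∫ p, ‖p.2‖ ^ 2 ∂γ := by
    rw [← h2, integral_map measurable_snd.aemeasurable (by fun_prop)]
  have e3 : ∫ y, ⟪y, wstar y⟫ ∂ν = ∫ p, ⟪p.2, wstar p.2⟫ ∂γ := by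
    rw [← h2, integral_map measurable_snd.aemeasurable (by fun_prop)]
  have e4 : ∫ p, ‖-wstar p.1 - p.2‖ ^ 2 ∂γ = (∫ p, ‖wstar p.1‖ ^ 2 ∂γ)
      + 2 * (∫ p, ⟪p.2, wstar p.1⟫ ∂γ) + ∫ p, ‖p.2‖ ^ 2 ∂γ := by
    rw [← integral_const_mul, ← integral_add iw2 (i1.const_mul 2),
      ← integral_add (f := fun p : Vec d × Vec d => ‖wstar p.1‖ ^ 2 + 2 * ⟪p.2, wstar p.1⟫)
        (iw2.add (i1.const_mul 2)) iy2]
    refine integral_congr_ae (.of_forall fun p => ?_)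
    simp only []
    rw [norm_sub_sq_real, norm_neg, inner_neg_left, real_inner_comm]
    ring
  have e5 : ∫ p, spoLoss wstar p.1 p.2 ∂γ = (∫ p, ⟪p.2, wstar p.1⟫ ∂γ)
      - ∫ p, ⟪p.2, wstar p.2⟫ ∂γ := integral_sub i1 i2
  rw [e1, e2, e3, e4, e5]
  ring

/-- **Quadratic optimal transport reformulation of `W^O_DF`.** For `μ, ν` with finite second
moments and `w̄* = −w*`:
`W^O_DF(μ,ν) = ½·[W₂²((w̄*)_#μ, ν) − ‖w*_#μ‖² − ‖ν‖²] − ∫ yᵀ w*(y) dν(y)`,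
where `‖ρ‖² = ∫ ‖z‖² dρ`. -/
theorem stmt8 {d : ℕ} (S : Set (Vec d)) (𝔖 : Finset (Vec d)) (wstar : Vec d → Vec d)
    (hSne : S.Nonempty) (hScomp : IsCompact S)
    (hext : (𝔖 : Set (Vec d)) = S.extremePoints ℝ)
    (hwmeas : Measurable wstar) (hwmem : ∀ x, wstar x ∈ 𝔖)
    (hwopt : ∀ x : Vec d, ∀ w ∈ S, ⟪wstar x, x⟫ ≤ ⟪w, x⟫)
    (μ ν : Measure (Vec d)) [IsProbabilityMeasure μ] [IsProbabilityMeasure ν]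
    (hμ2 : Integrable (fun x : Vec d => ‖x‖ ^ 2) μ)
    (hν2 : Integrable (fun y : Vec d => ‖y‖ ^ 2) ν) :
    WDFO wstar μ ν =
      (1 / 2) * (W2sq (μ.map (fun x => -wstar x)) ν
          - (∫ z, ‖z‖ ^ 2 ∂(μ.map wstar)) - ∫ z, ‖z‖ ^ 2 ∂ν)
        - ∫ y, ⟪y, wstar y⟫ ∂ν := by
  obtain ⟨C, hC⟩ : ∃ C : ℝ, ∀ x, ‖wstar x‖ ≤ C := by
    obtain ⟨C, hC⟩ := (𝔖.finite_toSet.isBounded).exists_norm_le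
    exact ⟨C, fun x => hC _ (hwmem x)⟩
  have hT : Measurable (fun x => -wstar x) := hwmeas.neg
  have hm : Measurable (fun p : Vec d × Vec d => (-wstar p.1, p.2)) := by fun_prop
  have hcost := coupling_cost wstar C hwmeas hC μ ν hν2
  have hmapint : ∀ γ : Measure (Vec d × Vec d),
      ∫ p, ‖p.1 - p.2‖ ^ 2 ∂(γ.map fun p => (-wstar p.1, p.2))
        = ∫ p, ‖-wstar p.1 - p.2‖ ^ 2 ∂γ := fun γ => by
    rw [integral_map hm.aemeasurable (by fun_prop)]
  unfold WDFO W2sq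
  set A := ∫ z, ‖z‖ ^ 2 ∂(μ.map wstar)
  set B := ∫ z, ‖z‖ ^ 2 ∂ν
  set D := ∫ y, ⟪y, wstar y⟫ ∂ν
  set W : Set ℝ := {r | ∃ π : Measure (Vec d × Vec d),
    IsCoupling (μ.map (fun x => -wstar x)) ν π ∧ r = ∫ p, ‖p.1 - p.2‖ ^ 2 ∂π} with hW
  have hP : IsProbabilityMeasure (μ.map (fun x => -wstar x)) :=
    Measure.isProbabilityMeasure_map hT.aemeasurable
  have hne : W.Nonempty :=
    ⟨_, (μ.map (fun x => -wstar x)).prod ν, ⟨Measure.fst_prod, Measure.snd_prod⟩, rfl⟩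
  have hbdd : BddBelow W := by
    refine ⟨0, ?_⟩
    rintro r ⟨π, -, rfl⟩
    exact integral_nonneg fun p => by positivity
  have himg : {r | ∃ γ : Measure (Vec d × Vec d), IsCoupling μ ν γ ∧
      r = ∫ p, spoLoss wstar p.1 p.2 ∂γ} = (fun r : ℝ => (1 / 2) * (r - A - B) - D) '' W := by
    ext r
    constructor
    · rintro ⟨γ, hγ, rfl⟩
      refine ⟨_, ⟨γ.map fun p => (-wstar p.1, p.2), ⟨?_, ?_⟩, rfl⟩, ?_⟩
      · rw [Measure.map_map measurable_fst hm, ← hγ.1, Measure.map_map hT measurable_fst]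
        rfl
      · rw [Measure.map_map measurable_snd hm]
        exact hγ.2
      · simp only [hmapint]
        exact (hcost γ hγ).symm
    · rintro ⟨_, ⟨π, hπ, rfl⟩, rfl⟩
      obtain ⟨γ, hγ, rfl⟩ := coupling_lift _ hT μ ν π hπ
      refine ⟨γ, hγ, ?_⟩
      simp only [hmapint]
      exact (hcost γ hγ).symm
  rw [himg]
  have hmono : Monotone (fun r : ℝ => (1 / 2) * (r - A - B) - D) := fun a b h => by
    simp only []
    linarith
  exact (hmono.map_csInf_of_continuousAt (by fun_prop) hne hbdd).symm
end
end

section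
/- Let γ* ∈ Γ((w̄*)_#μ, ν) be an optimal coupling for the quadratic cost c(w,y) = ‖w−y‖₂² between (w̄*)_#μ and ν. Define a measure γ on measurable rectangles by γ(A,B) := Σ_{k=1}^{K} γ*({−w_k} × B) · μ(A ∩ D_k)/μ(D_k), with the convention that the k-th term is 0 when μ(D_k) = 0. Then γ is a coupling in Γ(μ,ν), it satisfies γ(D_k × B) = γ*({−w_k} × B) for every k and every measurable B, and ∫ ℓ_SPO(x,y) dγ(x,y) = W^O_DF(μ,ν), i.e. γ attains the optimistic DF distance. -/
open MeasureTheory Set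
open scoped RealInnerProductSpace ENNReal

noncomputable section

/-- The lifted coupling of Theorem 2: on rectangles,
`γ(A × B) = Σ_k γ*({−w_k} × B) · μ(A ∩ D_k)/μ(D_k)`, where `D_k = {x : w*(x) = w_k}` and a
term is `0` whenever `μ(D_k) = 0`. -/
def liftCoupling {d : ℕ} (𝔖 : Finset (Vec d)) (wstar : Vec d → Vec d)
    (μ : Measure (Vec d)) (γstar : Measure (Vec d × Vec d)) : Measure (Vec d × Vec d) :=
  ∑ wk ∈ 𝔖, ((μ {x | wstar x = wk})⁻¹ • μ.restrict {x | wstar x = wk}).prod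
      ((γstar.restrict ({-wk} ×ˢ (univ : Set (Vec d)))).map Prod.snd)

theorem aux_split {α : Type*} [MeasurableSpace α] {d : ℕ} (m : Measure α) (𝔖 : Finset (Vec d))
    (f : α → Vec d) (hf : Measurable f) (hmem : ∀ᵐ a ∂m, f a ∈ 𝔖) (E : Set α)
    (hE : MeasurableSet E) : m E = ∑ w ∈ 𝔖, m (E ∩ {a | f a = w}) := by
  rw [← measure_biUnion_finset]
  · apply measure_congr
    filter_upwards [hmem] with a ha
    apply propext
    show a ∈ E ↔ a ∈ ⋃ w ∈ 𝔖, E ∩ {a | f a = w}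
    simp [ha]
  · intro w _ w' _ hne
    refine Set.disjoint_left.2 ?_
    rintro a ⟨_, h1⟩ ⟨_, h2⟩
    exact hne (h1.symm.trans h2)
  · intro w _
    exact hE.inter (hf (measurableSet_singleton w))

theorem aux_lift_rect {d : ℕ} (𝔖 : Finset (Vec d)) (wstar : Vec d → Vec d)
    (μ : Measure (Vec d)) (γstar : Measure (Vec d × Vec d)) [IsFiniteMeasure γstar]
    (A B : Set (Vec d)) (hA : MeasurableSet A) (hB : MeasurableSet B) :
    liftCoupling 𝔖 wstar μ γstar (A ×ˢ B) =
      ∑ wk ∈ 𝔖, (μ {x | wstar x = wk})⁻¹ * μ (A ∩ {x | wstar x = wk}) *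
        γstar ({-wk} ×ˢ B) := by
  unfold liftCoupling
  rw [Measure.finsetSum_apply]
  refine Finset.sum_congr rfl fun w _ => ?_
  rw [Measure.prod_prod, Measure.smul_apply, Measure.restrict_apply hA, smul_eq_mul,
    Measure.map_apply measurable_snd hB, Measure.restrict_apply (measurable_snd hB)]
  congr 2
  ext p
  simp [and_comm]

theorem aux_cost {d : ℕ} (𝔖 : Finset (Vec d)) (wstar : Vec d → Vec d)
    (hwmeas : Measurable wstar) (hwmem : ∀ x, wstar x ∈ 𝔖)
    (μ ν : Measure (Vec d)) [IsProbabilityMeasure μ] [IsProbabilityMeasure ν]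
    (hν2 : Integrable (fun y : Vec d => ‖y‖ ^ 2) ν)
    (γ : Measure (Vec d × Vec d)) (h : IsCoupling μ ν γ) :
    ∫ p, spoLoss wstar p.1 p.2 ∂γ =
      (1 / 2) * (∫ p, ‖p.1 - p.2‖ ^ 2 ∂(γ.map (fun p => (-wstar p.1, p.2))))
        - ((1 / 2) * (∫ x, ‖wstar x‖ ^ 2 ∂μ) + (1 / 2) * (∫ y, ‖y‖ ^ 2 ∂ν)
          + ∫ y, ⟪y, wstar y⟫ ∂ν) := by
  obtain ⟨h1, h2⟩ := h
  obtain ⟨C, hC⟩ : ∃ C : ℝ, ∀ x, ‖wstar x‖ ≤ C := by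
    refine ⟨∑ w ∈ 𝔖, ‖w‖, fun x => ?_⟩
    exact Finset.single_le_sum (f := fun w : Vec d => ‖w‖) (fun _ _ => norm_nonneg _) (hwmem x)
  have hy : Integrable (fun y : Vec d => ‖y‖) ν := by
    refine ((integrable_const (1 : ℝ)).add hν2).mono' (by fun_prop) ?_
    filter_upwards with y
    simp only [Pi.add_apply, norm_norm]
    nlinarith [sq_nonneg (‖y‖ - 1), norm_nonneg y]
  have hw2 : Integrable (fun x : Vec d => ‖wstar x‖ ^ 2) μ := by
    refine (integrable_const (C ^ 2)).mono' (by fun_prop) ?_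
    filter_upwards with x
    rw [Real.norm_of_nonneg (by positivity)]
    exact pow_le_pow_left₀ (norm_nonneg _) (hC x) 2
  have hyw : Integrable (fun y : Vec d => (⟪y, wstar y⟫ : ℝ)) ν := by
    refine (hy.mul_const C).mono' (by fun_prop) ?_
    filter_upwards with y
    exact (norm_inner_le_norm _ _).trans (mul_le_mul_of_nonneg_left (hC y) (norm_nonneg _))
  subst h1 h2
  have m1 : AEMeasurable (Prod.fst : Vec d × Vec d → Vec d) γ := measurable_fst.aemeasurable
  have m2 : AEMeasurable (Prod.snd : Vec d × Vec d → Vec d) γ := measurable_snd.aemeasurable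
  rw [integral_map m2 hyw.1, integral_map m2 hν2.1, integral_map m1 hw2.1,
    integral_map (by fun_prop) (by fun_prop)]
  have hy' : Integrable (fun p : Vec d × Vec d => ‖p.2‖) γ := hy.comp_aemeasurable m2
  have hyw' : Integrable (fun p : Vec d × Vec d => (⟪p.2, wstar p.2⟫ : ℝ)) γ :=
    hyw.comp_aemeasurable m2
  have hν2' : Integrable (fun p : Vec d × Vec d => ‖p.2‖ ^ 2) γ := hν2.comp_aemeasurable m2
  have hw2' : Integrable (fun p : Vec d × Vec d => ‖wstar p.1‖ ^ 2) γ :=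
    hw2.comp_aemeasurable m1
  have hc : Integrable (fun p : Vec d × Vec d => (⟪p.2, wstar p.1⟫ : ℝ)) γ := by
    refine (hy'.mul_const C).mono' (by fun_prop) ?_
    filter_upwards with p
    exact (norm_inner_le_norm _ _).trans (mul_le_mul_of_nonneg_left (hC p.1) (norm_nonneg _))
  have e : ∀ p : Vec d × Vec d, ‖-wstar p.1 - p.2‖ ^ 2 =
      ‖wstar p.1‖ ^ 2 + 2 * ⟪p.2, wstar p.1⟫ + ‖p.2‖ ^ 2 := by
    intro p
    rw [← neg_add', norm_neg, norm_add_sq_real, real_inner_comm]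
  simp only [e, spoLoss]
  have hs : Integrable (fun p : Vec d × Vec d =>
      ‖wstar p.1‖ ^ 2 + 2 * (⟪p.2, wstar p.1⟫ : ℝ)) γ := hw2'.add (hc.const_mul 2)
  rw [integral_sub hc hyw', integral_add hs hν2',
    integral_add hw2' (hc.const_mul 2), integral_const_mul]
  ring

/-- **Lifting optimal couplings.** If `γ*` is an optimal coupling for the quadratic cost
between `(w̄*)_#μ` and `ν` (with `w̄* = −w*`), then the lifted measure `γ` defined on
rectangles by `γ(A × B) = Σ_k γ*({−w_k} × B)·μ(A ∩ D_k)/μ(D_k)` is a coupling of `μ` and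
`ν`, satisfies `γ(D_k × B) = γ*({−w_k} × B)`, and attains the optimistic DF distance:
`∫ ℓ_SPO dγ = W^O_DF(μ,ν)`. -/
theorem stmt9 {d : ℕ} (S : Set (Vec d)) (𝔖 : Finset (Vec d)) (wstar : Vec d → Vec d)
    (hSne : S.Nonempty) (hScomp : IsCompact S)
    (hext : (𝔖 : Set (Vec d)) = S.extremePoints ℝ)
    (hwmeas : Measurable wstar) (hwmem : ∀ x, wstar x ∈ 𝔖)
    (hwopt : ∀ x : Vec d, ∀ w ∈ S, ⟪wstar x, x⟫ ≤ ⟪w, x⟫)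
    (μ ν : Measure (Vec d)) [IsProbabilityMeasure μ] [IsProbabilityMeasure ν]
    (hμ2 : Integrable (fun x : Vec d => ‖x‖ ^ 2) μ)
    (hν2 : Integrable (fun y : Vec d => ‖y‖ ^ 2) ν)
    (γstar : Measure (Vec d × Vec d))
    (hγstar : IsCoupling (μ.map (fun x => -wstar x)) ν γstar)
    (hγopt : ∫ p, ‖p.1 - p.2‖ ^ 2 ∂γstar = W2sq (μ.map (fun x => -wstar x)) ν) :
    IsCoupling μ ν (liftCoupling 𝔖 wstar μ γstar) ∧
    (∀ wk ∈ 𝔖, ∀ B : Set (Vec d), MeasurableSet B →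
      liftCoupling 𝔖 wstar μ γstar ({x | wstar x = wk} ×ˢ B) =
        γstar ({-wk} ×ˢ B)) ∧
    ∫ p, spoLoss wstar p.1 p.2 ∂(liftCoupling 𝔖 wstar μ γstar) = WDFO wstar μ ν := by
  obtain ⟨hg1, hg2⟩ := id hγstar
  have hfm : Measurable (fun x => -wstar x) := hwmeas.neg
  haveI : IsProbabilityMeasure γstar := by
    constructor
    have := congrArg (fun m => m univ) hg2
    simpa [Measure.map_apply measurable_snd MeasurableSet.univ] using this
  -- mass of the slices
  have hslice : ∀ wk : Vec d, γstar ({-wk} ×ˢ univ) = μ {x | wstar x = wk} := by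
    intro wk
    have := congrArg (fun m => m {-wk}) hg1
    simp only [Measure.map_apply measurable_fst (measurableSet_singleton (-wk)),
      Measure.map_apply hfm (measurableSet_singleton (-wk))] at this
    rw [prod_univ, this]
    congr 1
    ext x
    simp
  have hsupp : ∀ᵐ p ∂γstar, -p.1 ∈ 𝔖 := by
    have h0 : ∀ᵐ x ∂(γstar.map Prod.fst), -x ∈ 𝔖 := by
      rw [hg1, ae_map_iff hfm.aemeasurable]
      · simp [hwmem]
      · exact measurable_neg (Finset.measurableSet 𝔖)
    exact ae_of_ae_map measurable_fst.aemeasurable h0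
  have hcancel : ∀ wk : Vec d, ∀ B : Set (Vec d), (μ {x | wstar x = wk})⁻¹ *
      μ {x | wstar x = wk} * γstar ({-wk} ×ˢ B) = γstar ({-wk} ×ˢ B) := by
    intro wk B
    by_cases h0 : μ {x | wstar x = wk} = 0
    · have : γstar ({-wk} ×ˢ B) = 0 :=
        measure_mono_null (prod_mono_right (subset_univ B)) ((hslice wk).trans h0)
      simp [this]
    · rw [ENNReal.inv_mul_cancel h0 (measure_ne_top _ _), one_mul]
  have hfst : (liftCoupling 𝔖 wstar μ γstar).map Prod.fst = μ := by
    ext A hA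
    rw [Measure.map_apply measurable_fst hA, ← prod_univ,
      aux_lift_rect 𝔖 wstar μ γstar A univ hA MeasurableSet.univ,
      aux_split μ 𝔖 wstar hwmeas (by simp [hwmem]) A hA]
    refine Finset.sum_congr rfl fun w _ => ?_
    rw [hslice]
    by_cases h0 : μ {x | wstar x = w} = 0
    · rw [h0, mul_zero, measure_mono_null inter_subset_right h0]
    · rw [mul_right_comm, ENNReal.inv_mul_cancel h0 (measure_ne_top _ _), one_mul]
  haveI : IsProbabilityMeasure (liftCoupling 𝔖 wstar μ γstar) := by
    constructor
    have := congrArg (fun m => m univ) hfst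
    simpa [Measure.map_apply measurable_fst MeasurableSet.univ] using this
  have hFm : Measurable (fun p : Vec d × Vec d => (-wstar p.1, p.2)) := by fun_prop
  have hmap : (liftCoupling 𝔖 wstar μ γstar).map (fun p => (-wstar p.1, p.2)) = γstar := by
    haveI := Measure.isFiniteMeasure_map (liftCoupling 𝔖 wstar μ γstar)
      (fun p : Vec d × Vec d => (-wstar p.1, p.2))
    refine Measure.ext_prod fun {A B} hA hB => ?_
    rw [Measure.map_apply hFm (hA.prod hB)]
    have : (fun p : Vec d × Vec d => (-wstar p.1, p.2)) ⁻¹' (A ×ˢ B) =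
        ((fun x => -wstar x) ⁻¹' A) ×ˢ B := rfl
    rw [this, aux_lift_rect 𝔖 wstar μ γstar _ B (hfm hA) hB,
      aux_split γstar 𝔖 (fun p => -p.1) measurable_fst.neg hsupp _ (hA.prod hB)]
    refine Finset.sum_congr rfl fun w _ => ?_
    by_cases hw : -w ∈ A
    · have e1 : (fun x => -wstar x) ⁻¹' A ∩ {x | wstar x = w} = {x | wstar x = w} := by
        ext x
        simp only [mem_inter_iff, mem_preimage, mem_setOf_eq, and_iff_right_iff_imp]
        rintro rfl
        exact hw
      have e2 : A ×ˢ B ∩ {p : Vec d × Vec d | -p.1 = w} = {-w} ×ˢ B := by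
        ext ⟨x, y⟩
        simp only [mem_inter_iff, mem_prod, mem_setOf_eq, mem_singleton_iff]
        constructor
        · rintro ⟨⟨_, hy⟩, rfl⟩
          exact ⟨(neg_neg x).symm, hy⟩
        · rintro ⟨rfl, hy⟩
          exact ⟨⟨hw, hy⟩, neg_neg w⟩
      rw [e1, e2, hcancel]
    · have e1 : (fun x => -wstar x) ⁻¹' A ∩ {x | wstar x = w} = ∅ := by
        refine eq_empty_of_forall_notMem ?_
        rintro x ⟨hx, rfl⟩
        exact hw hx
      have e2 : A ×ˢ B ∩ {p : Vec d × Vec d | -p.1 = w} = ∅ := by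
        refine eq_empty_of_forall_notMem ?_
        rintro ⟨x, y⟩ ⟨⟨hx, _⟩, rfl⟩
        exact hw (by simpa using hx)
      simp [e1, e2]
  have hcoup : IsCoupling μ ν (liftCoupling 𝔖 wstar μ γstar) := by
    refine ⟨hfst, ?_⟩
    rw [← hg2]
    conv_rhs => rw [← hmap]
    rw [Measure.map_map measurable_snd hFm]
    rfl
  refine ⟨hcoup, ?_, ?_⟩
  · intro wk _ B hB
    conv_rhs => rw [← hmap]
    rw [Measure.map_apply hFm ((measurableSet_singleton _).prod hB)]
    congr 1
    ext p
    simp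
  · have key := aux_cost 𝔖 wstar hwmeas hwmem μ ν hν2
    have hleast : IsLeast {r | ∃ γ : Measure (Vec d × Vec d), IsCoupling μ ν γ ∧
        r = ∫ p, spoLoss wstar p.1 p.2 ∂γ}
        (∫ p, spoLoss wstar p.1 p.2 ∂(liftCoupling 𝔖 wstar μ γstar)) := by
      refine ⟨⟨_, hcoup, rfl⟩, ?_⟩
      rintro r ⟨γ, hγ, rfl⟩
      rw [key _ hcoup, key γ hγ, hmap, hγopt]
      have hle : W2sq (μ.map (fun x => -wstar x)) ν ≤
          ∫ p, ‖p.1 - p.2‖ ^ 2 ∂(γ.map (fun p => (-wstar p.1, p.2))) := by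
        refine csInf_le ⟨0, ?_⟩ ⟨_, ⟨?_, ?_⟩, rfl⟩
        · rintro r ⟨π, _, rfl⟩
          exact integral_nonneg fun p => by positivity
        · rw [Measure.map_map measurable_fst hFm, ← hγ.1, Measure.map_map hfm measurable_fst]
          rfl
        · rw [Measure.map_map measurable_snd hFm]
          exact hγ.2
      linarith
    exact hleast.csInf_eq.symm
end
end

section
/- Define z(y) := yᵀ w*(y) and reduced costs c_i(y) := yᵀ w_i − z(y) for i = 1,…,K, and let Φ_SPO be the set of pairs (f,g) ∈ ℝ^K × L¹(ν) satisfying f_i + g(y) ≤ c_i(y) for all i and all y ∈ ℝ^d. Then strong duality holds: W^O_DF(μ,ν) = sup_{(f,g)∈Φ_SPO} { Σ_{i=1}^{K} f_i · μ(D_i) + ∫ g(y) dν(y) }. Moreover, for any fixed f ∈ ℝ^K the optimal g is the envelope g_f(y) := min_{1≤i≤K} (c_i(y) − f_i), so that W^O_DF(μ,ν) = sup_{f∈ℝ^K} { Σ_i f_i · μ(D_i) + ∫ g_f(y) dν(y) }. -/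
open MeasureTheory Set
open scoped RealInnerProductSpace ENNReal

noncomputable section

section plans
variable {ι α : Type*} [Fintype ι] [MeasurableSpace α]

lemma plan_le {ν : Measure α} {P : ι → Measure α} (hP : ∑ i, P i = ν) (i : ι) : P i ≤ ν := by
  rw [← hP, Measure.le_iff]
  intro s _
  rw [Measure.finsetSum_apply]
  exact Finset.single_le_sum (f := fun i => P i s) (fun _ _ => zero_le) (Finset.mem_univ i)

lemma plan_fin {ν : Measure α} [IsFiniteMeasure ν] {P : ι → Measure α} (hP : ∑ i, P i = ν)
    (i : ι) : IsFiniteMeasure (P i) := isFiniteMeasure_of_le ν (plan_le hP i)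

lemma real_sum {P : ι → Measure α} (hf : ∀ i, IsFiniteMeasure (P i)) :
    (∑ i, P i).real univ = ∑ i, (P i).real univ := by
  simp only [measureReal_def, Measure.finsetSum_apply]
  exact ENNReal.toReal_sum (fun i _ => measure_ne_top _ _)

lemma plan_mass {ν : Measure α} [IsProbabilityMeasure ν] {P : ι → Measure α}
    (hP : ∑ i, P i = ν) : ∑ i, (P i).real univ = 1 := by
  rw [← real_sum (plan_fin hP), hP]
  simp

lemma plan_correct {ν : Measure α} [IsProbabilityMeasure ν] (c : ι → α → ℝ)
    (hc : ∀ i, Integrable (c i) ν) (hc0 : ∀ i y, 0 ≤ c i y) (M : ℝ)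
    (hcM : ∀ i, ∀ᵐ y ∂ν, c i y ≤ M) (m : ι → ℝ) (hm0 : ∀ i, 0 ≤ m i) (hm1 : ∑ i, m i = 1)
    (P : ι → Measure α) (hP : ∑ i, P i = ν) :
    ∃ Q : ι → Measure α, ∑ i, Q i = ν ∧ (∀ i, (Q i).real univ = m i) ∧
      ∑ i, ∫ y, c i y ∂(Q i) ≤ ∑ i, ∫ y, c i y ∂(P i)
        + M * ∑ i, (m i - min ((P i).real univ) (m i)) := by
  have hfin := plan_fin hP
  set a : ι → ℝ := fun i => (P i).real univ with ha
  have ha0 : ∀ i, 0 ≤ a i := fun i => measureReal_nonneg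
  have ha1 : ∑ i, a i = 1 := plan_mass hP
  set t : ι → ℝ := fun i => min (a i) (m i) with ht
  have ht0 : ∀ i, 0 ≤ t i := fun i => le_min (ha0 i) (hm0 i)
  have hta : ∀ i, t i ≤ a i := fun i => min_le_left _ _
  have htm : ∀ i, t i ≤ m i := fun i => min_le_right _ _
  set δ : ℝ := ∑ i, (m i - t i) with hδ
  have hδ0 : 0 ≤ δ := Finset.sum_nonneg fun i _ => sub_nonneg.2 (htm i)
  have hδ' : ∑ i, (a i - t i) = δ := by
    rw [hδ, Finset.sum_sub_distrib, Finset.sum_sub_distrib, ha1, hm1]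
  rcases hδ0.eq_or_lt with h0 | hpos
  · refine ⟨P, hP, fun i => ?_, ?_⟩
    · have h1 := (Finset.sum_eq_zero_iff_of_nonneg
        (fun i _ => sub_nonneg.2 (htm i))).1 (hδ.symm.trans h0.symm) i (Finset.mem_univ i)
      have h2 := (Finset.sum_eq_zero_iff_of_nonneg
        (fun i _ => sub_nonneg.2 (hta i))).1 (hδ'.trans h0.symm) i (Finset.mem_univ i)
      change a i = m i
      linarith
    · rw [← h0]; simp
  have hb0 : ∀ i, 0 ≤ t i / a i := fun i => div_nonneg (ht0 i) (ha0 i)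
  have hb1 : ∀ i, t i / a i ≤ 1 := fun i => div_le_one_of_le₀ (hta i) (ha0 i)
  have hba : ∀ i, t i / a i * a i = t i := by
    intro i
    rcases (ha0 i).eq_or_lt with h | h
    · have : t i = 0 := le_antisymm (by rw [h]; exact hta i) (ht0 i)
      simp [this]
    · field_simp
  set β : ι → NNReal := fun i => ⟨t i / a i, hb0 i⟩ with hβ
  set β' : ι → NNReal := fun i => ⟨1 - t i / a i, sub_nonneg.2 (hb1 i)⟩ with hβ'
  set η : ι → NNReal := fun i => ⟨(m i - t i) / δ, div_nonneg (sub_nonneg.2 (htm i)) hδ0⟩ with hη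
  have hη1 : ∑ i, η i = 1 := by
    apply NNReal.coe_injective
    push_cast
    change ∑ i, (m i - t i) / δ = 1
    rw [← Finset.sum_div]
    exact div_self hpos.ne'
  have hββ : ∀ i, β i + β' i = 1 := by
    intro i
    apply NNReal.coe_injective
    push_cast
    change t i / a i + (1 - t i / a i) = 1
    ring
  set ρ : Measure α := ∑ i, β' i • P i with hρ
  have hρle : ρ ≤ ν := by
    rw [← hP, hρ]
    refine Finset.sum_le_sum fun i _ => ?_
    conv_rhs => rw [← one_smul NNReal (P i), ← hββ i, add_smul]
    exact Measure.le_add_left le_rfl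
  have : IsFiniteMeasure ρ := isFiniteMeasure_of_le ν hρle
  have hρm : ρ.real univ = δ := by
    rw [hρ, real_sum (fun i => inferInstance), ← hδ']
    refine Finset.sum_congr rfl fun i _ => ?_
    rw [measureReal_nnreal_smul_apply]
    change (1 - t i / a i) * a i = _
    rw [sub_mul, hba, one_mul]
  have hcP : ∀ i j, Integrable (c i) (P j) := fun i j => (hc i).mono_measure (plan_le hP j)
  have hcρ : ∀ i, Integrable (c i) ρ := fun i => (hc i).mono_measure hρle
  have hcρM : ∀ i, ∫ y, c i y ∂ρ ≤ M * δ := by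
    intro i
    calc ∫ y, c i y ∂ρ ≤ ∫ y, M ∂ρ := by
          refine integral_mono_ae (hcρ i) (integrable_const _) ?_
          exact (Measure.absolutelyContinuous_of_le hρle).ae_le (hcM i)
      _ = M * δ := by rw [integral_const, hρm, smul_eq_mul, mul_comm]
  refine ⟨fun i => β i • P i + η i • ρ, ?_, ?_, ?_⟩
  · rw [Finset.sum_add_distrib, ← Finset.sum_smul, hη1, one_smul, hρ, ← Finset.sum_add_distrib,
      ← hP]
    refine Finset.sum_congr rfl fun i _ => ?_
    rw [← add_smul, hββ, one_smul]
  · intro i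
    rw [measureReal_add_apply, measureReal_nnreal_smul_apply, measureReal_nnreal_smul_apply, hρm]
    change t i / a i * a i + (m i - t i) / δ * δ = m i
    rw [hba, div_mul_cancel₀ _ hpos.ne']
    ring
  · have key : ∀ i, ∫ y, c i y ∂(β i • P i + η i • ρ) ≤ ∫ y, c i y ∂(P i) + M * (m i - t i) := by
      intro i
      rw [integral_add_measure ((hcP i i).smul_measure_nnreal) ((hcρ i).smul_measure_nnreal),
        integral_smul_nnreal_measure, integral_smul_nnreal_measure]
      change t i / a i * _ + (m i - t i) / δ * _ ≤ _
      have hI : 0 ≤ ∫ y, c i y ∂(P i) := integral_nonneg (hc0 i)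
      have h1 := mul_le_mul_of_nonneg_right (hb1 i) hI
      have h2 := mul_le_mul_of_nonneg_left (hcρM i) (η i).2
      change (m i - t i) / δ * _ ≤ (m i - t i) / δ * (M * δ) at h2
      have h3 : (m i - t i) / δ * (M * δ) = M * (m i - t i) := by field_simp
      linarith
    calc _ ≤ ∑ i, (∫ y, c i y ∂(P i) + M * (m i - t i)) := Finset.sum_le_sum fun i _ => key i
      _ = _ := by rw [Finset.sum_add_distrib, Finset.mul_sum]

lemma plan_dual {ν : Measure α} [IsProbabilityMeasure ν] (c : ι → α → ℝ)
    (hc : ∀ i, Integrable (c i) ν) (hc0 : ∀ i y, 0 ≤ c i y) (M : ℝ) (hM : 0 ≤ M)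
    (hcM : ∀ i, ∀ᵐ y ∂ν, c i y ≤ M) (m : ι → ℝ) (hm0 : ∀ i, 0 ≤ m i) (hm1 : ∑ i, m i = 1)
    (W : ℝ) (hW : ∀ Q : ι → Measure α, ∑ i, Q i = ν → (∀ i, (Q i).real univ = m i) →
      W ≤ ∑ i, ∫ y, c i y ∂(Q i)) (hex : ∃ P : ι → Measure α, ∑ i, P i = ν) :
    ∃ f : ι → ℝ, ∀ P : ι → Measure α, ∑ i, P i = ν →
      W ≤ ∑ i, f i * m i + ∑ i, (∫ y, c i y ∂(P i) - f i * (P i).real univ) := by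
  classical
  set L : ℝ := M * Fintype.card ι with hL
  have hL0 : 0 ≤ L := by positivity
  let A : Set ((ι → ℝ) × ℝ) := {p | ∃ P : ι → Measure α, ∑ i, P i = ν ∧
    p = (fun i => (P i).real univ, ∑ i, ∫ y, c i y ∂(P i))}
  let B : Set ((ι → ℝ) × ℝ) := {p | p.2 + L * ‖p.1 - m‖ < W}
  have hBo : IsOpen B := isOpen_lt (by fun_prop) continuous_const
  have hBc : Convex ℝ B := by
    rintro ⟨x, r⟩ hx ⟨y, s⟩ hy p q hp hq hpq
    change r + L * ‖x - m‖ < W at hx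
    change s + L * ‖y - m‖ < W at hy
    change (p * r + q * s) + L * ‖(p • x + q • y) - m‖ < W
    have e : (p • x + q • y) - m = p • (x - m) + q • (y - m) := by
      have : m = (p + q) • m := by rw [hpq, one_smul]
      conv_lhs => rw [this]
      rw [add_smul, smul_sub, smul_sub]; abel
    have h1 : ‖(p • x + q • y) - m‖ ≤ p * ‖x - m‖ + q * ‖y - m‖ := by
      rw [e]
      refine (norm_add_le _ _).trans ?_
      rw [norm_smul, norm_smul, Real.norm_of_nonneg hp, Real.norm_of_nonneg hq]
    have h2 := mul_le_mul_of_nonneg_left h1 hL0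
    have h3 : p * (r + L * ‖x - m‖) + q * (s + L * ‖y - m‖) < W := by
      have := (convex_Iio (𝕜 := ℝ) W) hx hy hp hq hpq
      simpa using this
    linarith
  have hAc : Convex ℝ A := by
    rintro _ ⟨P, hP, rfl⟩ _ ⟨Q, hQ, rfl⟩ p q hp hq hpq
    have hPf := plan_fin hP
    have hQf := plan_fin hQ
    lift p to NNReal using hp
    lift q to NNReal using hq
    have hpq' : p + q = 1 := by exact_mod_cast hpq
    refine ⟨fun i => p • P i + q • Q i, ?_, ?_⟩
    · rw [Finset.sum_add_distrib, ← Finset.smul_sum, ← Finset.smul_sum, hP, hQ, ← add_smul, hpq',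
        one_smul]
    · ext i
      · simp only [Prod.smul_mk, Prod.mk_add_mk, Pi.add_apply, Pi.smul_apply, smul_eq_mul]
        rw [measureReal_add_apply, measureReal_nnreal_smul_apply, measureReal_nnreal_smul_apply]
      · simp only [Prod.smul_mk, Prod.mk_add_mk, smul_eq_mul]
        rw [Finset.mul_sum, Finset.mul_sum, ← Finset.sum_add_distrib]
        refine Finset.sum_congr rfl fun i _ => ?_
        rw [integral_add_measure
          (((hc i).mono_measure (plan_le hP i)).smul_measure_nnreal)
          (((hc i).mono_measure (plan_le hQ i)).smul_measure_nnreal),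
          integral_smul_nnreal_measure, integral_smul_nnreal_measure]
        rfl
  have hdis : Disjoint B A := by
    rw [Set.disjoint_left]
    rintro _ hb ⟨P, hP, rfl⟩
    obtain ⟨Q, hQ, hQm, hQc⟩ := plan_correct c hc hc0 M hcM m hm0 hm1 P hP
    have h1 := hW Q hQ hQm
    change _ + L * ‖(fun i => (P i).real univ) - m‖ < W at hb
    have h2 : ∑ i, (m i - min ((P i).real univ) (m i)) ≤
        Fintype.card ι * ‖(fun i => (P i).real univ) - m‖ := by
      rw [← nsmul_eq_mul]
      refine Finset.sum_le_card_nsmul _ _ _ fun i _ => ?_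
      have h3 := norm_le_pi_norm ((fun i => (P i).real univ) - m) i
      refine le_trans ?_ h3
      simp only [Pi.sub_apply, Real.norm_eq_abs]
      rcases le_total ((P i).real univ) (m i) with h | h
      · rw [min_eq_left h, abs_sub_comm]; exact le_abs_self _
      · rw [min_eq_right h, sub_self]; exact abs_nonneg _
    have h3 := mul_le_mul_of_nonneg_left h2 hM
    have h4 : L * ‖(fun i => (P i).real univ) - m‖ =
      M * (Fintype.card ι * ‖(fun i => (P i).real univ) - m‖) := by rw [hL]; ring
    linarith
  obtain ⟨φ, u, hφB, hφA⟩ := geometric_hahn_banach_open hBc hBo hAc hdis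
  set s : ℝ := φ (0, 1) with hs
  have hφ : ∀ x r, φ (x, r) = φ (x, 0) + r * s := by
    intro x r
    have : ((x, r) : (ι → ℝ) × ℝ) = (x, 0) + r • (0, 1) := by simp
    rw [this, map_add, map_smul, smul_eq_mul]
  obtain ⟨P0, hP0⟩ := hex
  set a0 : ι → ℝ := fun i => (P0 i).real univ
  set r0 : ℝ := ∑ i, ∫ y, c i y ∂(P0 i)
  have hA0 : u ≤ φ (a0, r0) := hφA _ ⟨P0, hP0, rfl⟩
  have hspos : 0 < s := by
    have hk : (a0, min r0 (W - L * ‖a0 - m‖ - 1)) ∈ B := by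
      change min r0 _ + _ < W
      have := min_le_right r0 (W - L * ‖a0 - m‖ - 1)
      linarith
    have h1 := hφB _ hk
    rw [hφ] at h1 hA0
    have h2 : min r0 (W - L * ‖a0 - m‖ - 1) ≤ r0 := min_le_left _ _
    by_contra hneg
    push Not at hneg
    nlinarith
  have hu : φ (m, 0) + W * s ≤ u := by
    by_contra hlt
    push Not at hlt
    have hk : (m, W - (φ (m, 0) + W * s - u) / s) ∈ B := by
      change W - _ + L * ‖m - m‖ < W
      have : 0 < (φ (m, 0) + W * s - u) / s := div_pos (by linarith) hspos
      simp only [sub_self, norm_zero, mul_zero]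
      linarith
    have h1 := hφB _ hk
    rw [hφ, sub_mul, div_mul_cancel₀ _ hspos.ne'] at h1
    linarith
  have hlin : ∀ x : ι → ℝ, φ (x, 0) = ∑ i, x i * φ (Pi.single i 1, 0) := by
    intro x
    have : ((x, 0) : (ι → ℝ) × ℝ) = ∑ i, x i • ((Pi.single i 1 : ι → ℝ), (0 : ℝ)) := by
      ext j
      · simp [Prod.fst_sum, Finset.sum_apply, Pi.single_apply]
      · simp [Prod.snd_sum]
    rw [this, map_sum]
    exact Finset.sum_congr rfl fun i _ => by rw [map_smul, smul_eq_mul]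
  refine ⟨fun i => - φ (Pi.single i 1, 0) / s, fun P hP => ?_⟩
  have h1 : u ≤ _ := hφA _ ⟨P, hP, rfl⟩
  rw [hφ, hlin] at h1
  rw [hlin] at hu
  have h2 := hu.trans h1
  rw [Finset.sum_sub_distrib]
  have e : ∀ x : ι → ℝ, ∑ i, (- φ (Pi.single i 1, 0) / s) * x i =
      - (∑ i, x i * φ (Pi.single i 1, 0)) / s := by
    intro x
    rw [← Finset.sum_neg_distrib, Finset.sum_div]
    refine Finset.sum_congr rfl fun i _ => ?_
    ring
  rw [e m, e (fun i => (P i).real univ)]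
  rw [← sub_nonneg] at h2 ⊢
  have h3 := div_nonneg h2 hspos.le
  refine h3.trans_eq ?_
  field_simp
  ring

end plans

lemma sum_restrict_fiber {α E : Type*} [MeasurableSpace α] [MeasurableSpace E]
    [MeasurableSingletonClass E] (ν : Measure α) (s : Finset E) (σ : α → E) (hσ : Measurable σ)
    (hmem : ∀ x, σ x ∈ s) : ∑ w : s, ν.restrict {x | σ x = w} = ν := by
  ext t ht
  rw [Measure.finsetSum_apply]
  have h1 : ∀ w : s, ν.restrict {x | σ x = w} t = ν.restrict t (σ ⁻¹' {(w : E)}) := by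
    intro w
    rw [Measure.restrict_apply ht, Measure.restrict_apply (hσ (measurableSet_singleton _)),
      inter_comm]
    rfl
  simp only [h1]
  rw [Finset.sum_coe_sort s (fun w => ν.restrict t (σ ⁻¹' {w})),
    sum_measure_preimage_singleton s (fun y _ => hσ (measurableSet_singleton y))]
  have h2 : σ ⁻¹' (s : Set E) = univ := eq_univ_of_forall fun x => hmem x
  rw [h2, Measure.restrict_apply_univ]

lemma integral_fiber {α E : Type*} [MeasurableSpace α] [MeasurableSpace E]
    [MeasurableSingletonClass E] (ν : Measure α) [IsFiniteMeasure ν] (s : Finset E) (σ : α → E)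
    (hσ : Measurable σ) (hmem : ∀ x, σ x ∈ s) (f : E → ℝ) :
    Integrable (fun x => f (σ x)) ν ∧
      ∫ x, f (σ x) ∂ν = ∑ w ∈ s, f w * (ν {x | σ x = w}).toReal := by
  have hm : ∀ w : E, MeasurableSet {x | σ x = w} := fun w => hσ (measurableSet_singleton w)
  have e : (fun x => f (σ x)) = fun x => ∑ w ∈ s, ({x | σ x = w}).indicator (fun _ => f w) x := by
    classical
    funext x
    simp only [indicator_apply, mem_ofPred_eq]
    rw [Finset.sum_ite_eq]
    simp [hmem x]
  have hi : ∀ w ∈ s, Integrable (({x | σ x = w}).indicator (fun _ => f w)) ν :=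
    fun w _ => (integrable_const _).indicator (hm w)
  rw [e]
  refine ⟨integrable_finsetSum _ hi, ?_⟩
  rw [integral_finsetSum _ hi]
  refine Finset.sum_congr rfl fun w _ => ?_
  rw [integral_indicator_const _ (hm w), smul_eq_mul, mul_comm, measureReal_def]

lemma exists_argmin {α E : Type*} [MeasurableSpace α] [MeasurableSpace E]
    (s : Finset E) (hs : s.Nonempty) (h : E → α → ℝ) (hh : ∀ w, Measurable (h w)) :
    ∃ σ : α → E, Measurable σ ∧ Measurable (fun y => h (σ y) y) ∧
      ∀ y, σ y ∈ s ∧ ∀ w ∈ s, h (σ y) y ≤ h w y := by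
  classical
  induction hs using Finset.Nonempty.cons_induction with
  | singleton a => exact ⟨fun _ => a, measurable_const, hh a, by simp⟩
  | cons a s ha hs ih =>
    obtain ⟨σ, h1, h2, h3⟩ := ih
    have hset : MeasurableSet {y | h a y ≤ h (σ y) y} := measurableSet_le (hh a) h2
    refine ⟨fun y => if h a y ≤ h (σ y) y then a else σ y,
      Measurable.ite hset measurable_const h1, ?_, ?_⟩
    · have : (fun y => h (if h a y ≤ h (σ y) y then a else σ y) y) =
          fun y => if h a y ≤ h (σ y) y then h a y else h (σ y) y := by
        funext y; split_ifs <;> rfl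
      rw [this]
      exact Measurable.ite hset (hh a) h2
    · intro y
      obtain ⟨h4, h5⟩ := h3 y
      beta_reduce
      split_ifs with hc
      · refine ⟨by simp, fun w hw => ?_⟩
        rcases Finset.mem_cons.1 hw with rfl | hw
        · exact le_rfl
        · exact hc.trans (h5 w hw)
      · refine ⟨by simp [h4], fun w hw => ?_⟩
        rcases Finset.mem_cons.1 hw with rfl | hw
        · exact (not_le.1 hc).le
        · exact h5 w hw

lemma exists_coupling {α β E : Type*} [MeasurableSpace α] [MeasurableSpace β] [MeasurableSpace E]
    [MeasurableSingletonClass E] (μ : Measure α) [IsFiniteMeasure μ] (ν : Measure β)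
    [IsFiniteMeasure ν] (s : Finset E) (σ : α → E)
    (hσ : Measurable σ) (hmem : ∀ x, σ x ∈ s) (Q : s → Measure β) (hQ : ∑ w, Q w = ν)
    (hQm : ∀ w : s, (Q w).real univ = μ.real {x | σ x = w}) (c : E → β → ℝ)
    (hc : ∀ w ∈ s, Integrable (c w) ν) (l : α × β → ℝ) (hl : ∀ x y, l (x, y) = c (σ x) y) :
    ∃ γ : Measure (α × β), IsCoupling μ ν γ ∧ ∫ p, l p ∂γ = ∑ w : s, ∫ y, c w y ∂(Q w) := by
  have hfin := plan_fin hQ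
  have hm : ∀ w : E, MeasurableSet {x | σ x = w} := fun w => hσ (measurableSet_singleton w)
  set k : s → NNReal := fun w => (μ {x | σ x = w}).toNNReal with hk
  have hk1 : ∀ w : s, μ {x | σ x = w} = k w := fun w =>
    (ENNReal.coe_toNNReal (measure_ne_top _ _)).symm
  have hk2 : ∀ w : s, Q w univ = k w := by
    intro w
    rw [← hk1]
    exact (ENNReal.toReal_eq_toReal_iff' (measure_ne_top _ _) (measure_ne_top _ _)).1 (hQm w)
  have hQ0 : ∀ w : s, k w = 0 → Q w = 0 := by
    intro w h
    rw [← Measure.measure_univ_eq_zero, hk2, h]; rfl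
  have hμ0 : ∀ w : s, k w = 0 → μ.restrict {x | σ x = w} = 0 := by
    intro w h
    rw [Measure.restrict_eq_zero, hk1, h]; rfl
  have hcan : ∀ (w : s) {X : Type _} [MeasurableSpace X] (ρ : Measure X), (k w = 0 → ρ = 0) →
      (k w)⁻¹ • ((k w : ℝ≥0∞) • ρ) = ρ := by
    intro w X _ ρ h
    by_cases h0 : k w = 0
    · rw [h h0]; simp
    · change (k w)⁻¹ • ((k w) • ρ) = ρ
      rw [smul_smul, inv_mul_cancel₀ h0, one_smul]
  have hcan' : ∀ (w : s) {X : Type _} [MeasurableSpace X] (ρ : Measure X), (k w = 0 → ρ = 0) →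
      (k w)⁻¹ • ((k w : ℝ≥0∞) • ρ) = ρ := by
    intro w X _ ρ h
    by_cases h0 : k w = 0
    · rw [h h0]; simp
    · change (k w)⁻¹ • ((k w) • ρ) = ρ
      rw [smul_smul, inv_mul_cancel₀ h0, one_smul]
  have hae : ∀ w : s, l =ᵐ[(μ.restrict {x | σ x = w}).prod (Q w)] fun p => c w p.2 := by
    intro w
    have h1 : ∀ᵐ x ∂(μ.restrict {x | σ x = w}), σ x = w := ae_restrict_mem (hm w)
    have h2 := (Measure.quasiMeasurePreserving_fst
      (μ := μ.restrict {x | σ x = w}) (ν := Q w)).ae h1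
    filter_upwards [h2] with p hp
    rw [← Prod.mk.eta (p := p), hl, hp]
  have hint : ∀ w : s, Integrable l ((μ.restrict {x | σ x = w}).prod (Q w)) := by
    intro w
    refine Integrable.congr ?_ (hae w).symm
    exact ((hc w w.2).mono_measure (plan_le hQ w)).comp_snd _
  refine ⟨∑ w : s, (k w)⁻¹ • (μ.restrict {x | σ x = w}).prod (Q w), ⟨?_, ?_⟩, ?_⟩
  · rw [Measure.map_finset_sum measurable_fst.aemeasurable]
    conv_rhs => rw [← sum_restrict_fiber μ s σ hσ hmem]
    refine Finset.sum_congr rfl fun w _ => ?_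
    rw [Measure.map_smul, Measure.map_fst_prod, hk2]
    exact hcan w _ (hμ0 w)
  · rw [Measure.map_finset_sum measurable_snd.aemeasurable]
    conv_rhs => rw [← hQ]
    refine Finset.sum_congr rfl fun w _ => ?_
    rw [Measure.map_smul, Measure.map_snd_prod, Measure.restrict_apply_univ, hk1]
    exact hcan' w _ (hQ0 w)
  · rw [integral_finsetSum_measure fun w _ => (hint w).smul_measure_nnreal]
    refine Finset.sum_congr rfl fun w _ => ?_
    rw [integral_smul_nnreal_measure, integral_congr_ae (hae w), integral_fun_snd,
      measureReal_def, Measure.restrict_apply_univ, hk1]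
    change ((k w)⁻¹ : NNReal) • ((k w) • (∫ y, c w y ∂(Q w))) = _
    by_cases h0 : k w = 0
    · rw [hQ0 w h0]; simp
    · rw [smul_smul, inv_mul_cancel₀ h0, one_smul]

/-- **Strong duality for the optimistic DF distance.** With reduced costs
`c_w(y) = yᵀ w − yᵀ w*(y)` and oracle regions `D_w = {x : w*(x) = w}`:
`W^O_DF(μ,ν) = sup {Σ_w f(w)·μ(D_w) + ∫ g dν : f + g ≤ c pointwise, g ∈ L¹(ν)}`, and the
supremum may be reduced to the envelope `g_f(y) = min_w (c_w(y) − f(w))`. -/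
theorem stmt10 {d : ℕ} (S : Set (Vec d)) (𝔖 : Finset (Vec d)) (wstar : Vec d → Vec d)
    (hSne : S.Nonempty) (hScomp : IsCompact S)
    (hext : (𝔖 : Set (Vec d)) = S.extremePoints ℝ) (h𝔖ne : 𝔖.Nonempty)
    (hwmeas : Measurable wstar) (hwmem : ∀ x, wstar x ∈ 𝔖)
    (hwopt : ∀ x : Vec d, ∀ w ∈ S, ⟪wstar x, x⟫ ≤ ⟪w, x⟫)
    (𝒴 : Set (Vec d)) (h𝒴 : Bornology.IsBounded 𝒴)
    (μ ν : Measure (Vec d)) [IsProbabilityMeasure μ] [IsProbabilityMeasure ν]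
    (hμsupp : μ 𝒴ᶜ = 0) (hνsupp : ν 𝒴ᶜ = 0) :
    WDFO wstar μ ν =
      sSup {r | ∃ f : Vec d → ℝ, ∃ g : Vec d → ℝ, Integrable g ν ∧
        (∀ w ∈ 𝔖, ∀ y : Vec d, f w + g y ≤ ⟪y, w⟫ - ⟪y, wstar y⟫) ∧
        r = (∑ w ∈ 𝔖, f w * (μ {x | wstar x = w}).toReal) + ∫ y, g y ∂ν} ∧
    WDFO wstar μ ν =
      sSup {r | ∃ f : Vec d → ℝ,
        r = (∑ w ∈ 𝔖, f w * (μ {x | wstar x = w}).toReal) +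
          ∫ y, 𝔖.inf' h𝔖ne (fun w => (⟪y, w⟫ - ⟪y, wstar y⟫) - f w) ∂ν} := by
  classical
  set c : Vec d → Vec d → ℝ := fun w y => ⟪y, w⟫ - ⟪y, wstar y⟫ with hc
  have hsub : ∀ w ∈ 𝔖, w ∈ S := fun w hw => by
    have : w ∈ (𝔖 : Set (Vec d)) := hw
    rw [hext] at this
    exact extremePoints_subset this
  have hc0 : ∀ w ∈ 𝔖, ∀ y, 0 ≤ c w y := by
    intro w hw y
    have := hwopt y w (hsub w hw)
    rw [real_inner_comm, real_inner_comm y w] at this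
    exact sub_nonneg.2 this
  have hcmeas : ∀ w, Measurable (c w) := by
    intro w
    exact (measurable_id.inner measurable_const).sub (measurable_id.inner hwmeas)
  obtain ⟨R, hR⟩ := h𝒴.exists_norm_le
  set N : ℝ := ∑ w ∈ 𝔖, ‖w‖ with hN
  have hN0 : 0 ≤ N := Finset.sum_nonneg fun _ _ => norm_nonneg _
  have hNw : ∀ w ∈ 𝔖, ‖w‖ ≤ N := fun w hw =>
    Finset.single_le_sum (f := fun w : Vec d => ‖w‖) (fun _ _ => norm_nonneg _) hw
  set M : ℝ := 2 * (max R 0 * N) with hMdef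
  have hM : 0 ≤ M := by positivity
  have hcM : ∀ w ∈ 𝔖, ∀ y ∈ 𝒴, c w y ≤ M := by
    intro w hw y hy
    have hyR : ‖y‖ ≤ max R 0 := (hR y hy).trans (le_max_left _ _)
    have h1 : ∀ v ∈ 𝔖, |⟪y, v⟫| ≤ max R 0 * N := fun v hv =>
      (abs_real_inner_le_norm y v).trans
        (mul_le_mul hyR (hNw v hv) (norm_nonneg _) (le_max_right _ _))
    have h2 := (abs_le.1 (h1 w hw)).2
    have h3 := (abs_le.1 (h1 _ (hwmem y))).1
    change ⟪y, w⟫ - ⟪y, wstar y⟫ ≤ M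
    linarith
  have hνae : ∀ᵐ y ∂ν, y ∈ 𝒴 := hνsupp
  have hcint : ∀ w ∈ 𝔖, Integrable (c w) ν := by
    intro w hw
    refine Integrable.of_bound (hcmeas w).aestronglyMeasurable M ?_
    filter_upwards [hνae] with y hy
    rw [Real.norm_of_nonneg (hc0 w hw y)]
    exact hcM w hw y hy
  have hlmeas : Measurable (fun p : Vec d × Vec d => spoLoss wstar p.1 p.2) := by
    unfold spoLoss
    exact (measurable_snd.inner (hwmeas.comp measurable_fst)).sub
      (measurable_snd.inner (hwmeas.comp measurable_snd))
  -- the primal set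
  set T : Set ℝ := {r | ∃ γ : Measure (Vec d × Vec d), IsCoupling μ ν γ ∧
    r = ∫ p, spoLoss wstar p.1 p.2 ∂γ} with hT
  have hTne : T.Nonempty := ⟨_, μ.prod ν, ⟨by simp, by simp⟩, rfl⟩
  have hTbdd : BddBelow T := by
    refine ⟨0, ?_⟩
    rintro _ ⟨γ, _, rfl⟩
    exact integral_nonneg fun p => hc0 _ (hwmem p.1) p.2
  have hWle : ∀ r ∈ T, WDFO wstar μ ν ≤ r := fun r hr => csInf_le hTbdd hr
  -- weak duality
  have hweak : ∀ (f g : Vec d → ℝ), Integrable g ν →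
      (∀ w ∈ 𝔖, ∀ y : Vec d, f w + g y ≤ c w y) →
      (∑ w ∈ 𝔖, f w * (μ {x | wstar x = w}).toReal) + ∫ y, g y ∂ν ≤ WDFO wstar μ ν := by
    intro f g hg hfg
    refine le_csInf hTne ?_
    rintro _ ⟨γ, ⟨h1, h2⟩, rfl⟩
    have hγ : IsFiniteMeasure γ := by
      refine ⟨?_⟩
      have : γ.map Prod.fst univ = 1 := by rw [h1]; simp
      rw [Measure.map_apply measurable_fst MeasurableSet.univ, preimage_univ] at this
      rw [this]; exact ENNReal.one_lt_top
    have hγae : ∀ᵐ p ∂γ, p.2 ∈ 𝒴 := by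
      refine ae_of_ae_map (p := fun y => y ∈ 𝒴) measurable_snd.aemeasurable ?_
      rw [h2]; exact hνae
    have hl : Integrable (fun p : Vec d × Vec d => spoLoss wstar p.1 p.2) γ := by
      refine Integrable.of_bound hlmeas.aestronglyMeasurable M ?_
      filter_upwards [hγae] with p hp
      have h0 : 0 ≤ spoLoss wstar p.1 p.2 := hc0 _ (hwmem p.1) p.2
      rw [Real.norm_of_nonneg h0]
      exact hcM _ (hwmem p.1) p.2 hp
    obtain ⟨hfi, hfe⟩ := integral_fiber μ 𝔖 wstar hwmeas hwmem f
    have hfi' : Integrable (fun p : Vec d × Vec d => f (wstar p.1)) γ := by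
      rw [← h1] at hfi
      exact hfi.comp_measurable measurable_fst
    have hgi' : Integrable (fun p : Vec d × Vec d => g p.2) γ := by
      rw [← h2] at hg
      exact hg.comp_measurable measurable_snd
    have e1 : ∫ p, f (wstar p.1) ∂γ = ∫ x, f (wstar x) ∂μ := by
      rw [← h1] at hfi ⊢
      exact (integral_map measurable_fst.aemeasurable hfi.aestronglyMeasurable).symm
    have e2 : ∫ p, g p.2 ∂γ = ∫ y, g y ∂ν := by
      rw [← h2] at hg ⊢
      exact (integral_map measurable_snd.aemeasurable hg.aestronglyMeasurable).symm
    rw [← hfe, ← e1, ← e2, ← integral_add hfi' hgi']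
    exact integral_mono (hfi'.add hgi') hl fun p => hfg _ (hwmem p.1) p.2
  -- the envelope is feasible
  have henvi : ∀ f : Vec d → ℝ,
      Integrable (fun y => 𝔖.inf' h𝔖ne (fun w => c w y - f w)) ν := by
    intro f
    have h1 : Integrable (𝔖.inf' h𝔖ne (fun w y => c w y - f w)) ν := by
      refine Finset.inf'_induction (p := fun g => Integrable g ν) h𝔖ne _
        (fun a ha b hb => ha.inf hb) fun w hw => (hcint w hw).sub (integrable_const _)
    refine h1.congr (Filter.Eventually.of_forall fun y => ?_)
    exact Finset.inf'_apply _ _ _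
  have henvf : ∀ f : Vec d → ℝ, ∀ w ∈ 𝔖, ∀ y : Vec d,
      f w + 𝔖.inf' h𝔖ne (fun w => c w y - f w) ≤ c w y := by
    intro f w hw y
    have := Finset.inf'_le (fun w => c w y - f w) hw
    linarith
  -- strong duality
  have hstrong : ∃ f : Vec d → ℝ, WDFO wstar μ ν ≤
      (∑ w ∈ 𝔖, f w * (μ {x | wstar x = w}).toReal) +
        ∫ y, 𝔖.inf' h𝔖ne (fun w => c w y - f w) ∂ν := by
    have hm1 : ∑ w : 𝔖, μ.real {x | wstar x = w} = 1 := by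
      have := plan_mass (sum_restrict_fiber μ 𝔖 wstar hwmeas hwmem)
      simpa [measureReal_def] using this
    obtain ⟨f, hf⟩ := plan_dual (ι := 𝔖) (ν := ν) (fun w y => c w y) (fun w => hcint w w.2)
      (fun w y => hc0 w w.2 y) M hM (fun w => by
        filter_upwards [hνae] with y hy using hcM w w.2 y hy)
      (fun w => μ.real {x | wstar x = w}) (fun _ => measureReal_nonneg) hm1
      (WDFO wstar μ ν) (by
        intro Q hQ hQm
        obtain ⟨γ, hγ, hγc⟩ := exists_coupling μ ν 𝔖 wstar hwmeas hwmem Q hQ hQm c hcint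
          (fun p => spoLoss wstar p.1 p.2) (fun _ _ => rfl)
        rw [← hγc]
        exact hWle _ ⟨γ, hγ, rfl⟩)
      ⟨_, sum_restrict_fiber ν 𝔖 wstar hwmeas hwmem⟩
    set F : Vec d → ℝ := fun w => if h : w ∈ 𝔖 then f ⟨w, h⟩ else 0 with hF
    have hFf : ∀ w : 𝔖, f w = F w := fun w => by simp [hF]
    refine ⟨F, ?_⟩
    obtain ⟨σ, hσ, -, hσmin⟩ := exists_argmin 𝔖 h𝔖ne (fun w y => c w y - F w)
      (fun w => (hcmeas w).sub_const _)
    have hsum := sum_restrict_fiber ν 𝔖 σ hσ (fun y => (hσmin y).1)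
    have h1 := hf _ hsum
    refine h1.trans_eq ?_
    congr 1
    · rw [← Finset.sum_coe_sort 𝔖]
      exact Finset.sum_congr rfl fun w _ => by rw [hFf]; rfl
    · conv_rhs => rw [← hsum]
      rw [integral_finsetSum_measure fun w _ => (henvi F).mono_measure Measure.restrict_le_self]
      refine Finset.sum_congr rfl fun w _ => ?_
      have hms : MeasurableSet {y | σ y = w} := hσ (measurableSet_singleton _)
      have h2 : ∫ y in {y | σ y = w}, 𝔖.inf' h𝔖ne (fun w => c w y - F w) ∂ν =
          ∫ y in {y | σ y = w}, (c w y - F w) ∂ν := by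
        refine setIntegral_congr_fun hms fun y hy => ?_
        have hy' : σ y = w := hy
        refine le_antisymm (Finset.inf'_le (fun w => c w y - F w) w.2) ?_
        refine Finset.le_inf' _ _ fun v hv => ?_
        have := (hσmin y).2 v hv
        rw [hy'] at this
        exact this
      rw [h2, integral_sub ((hcint w w.2).mono_measure Measure.restrict_le_self)
        (integrable_const _), integral_const, hFf, smul_eq_mul, mul_comm]
  obtain ⟨f0, hf0⟩ := hstrong
  constructor
  · refine (IsLUB.csSup_eq ⟨?_, ?_⟩ ?_).symm
    · rintro _ ⟨f, g, hg, hfg, rfl⟩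
      exact hweak f g hg hfg
    · intro b hb
      exact hf0.trans (hb ⟨f0, _, henvi f0, henvf f0, rfl⟩)
    · exact ⟨_, f0, _, henvi f0, henvf f0, rfl⟩
  · refine (IsLUB.csSup_eq ⟨?_, ?_⟩ ?_).symm
    · rintro _ ⟨f, rfl⟩
      exact hweak f _ (henvi f) (henvf f)
    · intro b hb
      exact hf0.trans (hb ⟨f0, rfl⟩)
    · exact ⟨_, f0, rfl⟩
end
end

section
/- Let μ, ν be probability measures on ℝ^d with finite second moments, and let γ* ∈ Γ(μ,ν) be an optimizer for the optimistic DF distance W^O_DF(μ,ν). For t ∈ [0,1], define π_t(u,v) := (1−t)u + tv and the interpolant marginal ν_t := (π_t)_#γ*. Then for all t ∈ [0,1], W^O_DF(μ, ν_t) ≤ t · W^O_DF(μ,ν). -/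
open MeasureTheory Set
open scoped RealInnerProductSpace ENNReal

noncomputable section

/-- **One-sided bound along the optimistic DF interpolant.** If `γ*` is an optimal coupling
for `W^O_DF(μ,ν)` and `ν_t = (π_t)_#γ*` with `π_t(u,v) = (1−t)u + tv`, then for all
`t ∈ [0,1]`: `W^O_DF(μ, ν_t) ≤ t · W^O_DF(μ,ν)`. -/
theorem stmt13 {d : ℕ} (S : Set (Vec d)) (𝔖 : Finset (Vec d)) (wstar : Vec d → Vec d)
    (hSne : S.Nonempty) (hScomp : IsCompact S)
    (hext : (𝔖 : Set (Vec d)) = S.extremePoints ℝ)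
    (hwmeas : Measurable wstar) (hwmem : ∀ x, wstar x ∈ 𝔖)
    (hwopt : ∀ x : Vec d, ∀ w ∈ S, ⟪wstar x, x⟫ ≤ ⟪w, x⟫)
    (μ ν : Measure (Vec d)) [IsProbabilityMeasure μ] [IsProbabilityMeasure ν]
    (hμ2 : Integrable (fun x : Vec d => ‖x‖ ^ 2) μ)
    (hν2 : Integrable (fun y : Vec d => ‖y‖ ^ 2) ν)
    (γstar : Measure (Vec d × Vec d)) (hγstar : IsCoupling μ ν γstar)
    (hγopt : ∫ p, spoLoss wstar p.1 p.2 ∂γstar = WDFO wstar μ ν) :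
    ∀ t ∈ Set.Icc (0 : ℝ) 1,
      WDFO wstar μ (γstar.map (fun p => (1 - t) • p.1 + t • p.2)) ≤
        t * WDFO wstar μ ν := by
  intro t ht
  have hmemS : ∀ x, wstar x ∈ S := fun x => by
    have h : wstar x ∈ (𝔖 : Set (Vec d)) := hwmem x
    rw [hext] at h
    exact h.1
  have hopt : ∀ x z : Vec d, ⟪x, wstar x⟫ ≤ ⟪x, wstar z⟫ := fun x z => by
    have h := hwopt x (wstar z) (hmemS z)
    rwa [real_inner_comm x, real_inner_comm x] at h
  have hnn : ∀ x y, 0 ≤ spoLoss wstar x y := fun x y => by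
    have h := hopt y x
    unfold spoLoss
    linarith
  have hmeas : Measurable (fun p : Vec d × Vec d => spoLoss wstar p.1 p.2) := by
    unfold spoLoss
    exact (measurable_snd.inner (hwmeas.comp measurable_fst)).sub
      (measurable_snd.inner (hwmeas.comp measurable_snd))
  obtain ⟨C, hC⟩ := hScomp.isBounded.exists_norm_le
  have hγp : IsProbabilityMeasure γstar := by
    constructor
    have h : (γstar.map Prod.fst) univ = 1 := by
      rw [hγstar.1]
      exact measure_univ
    rwa [Measure.map_apply measurable_fst MeasurableSet.univ, preimage_univ] at h
  have hsnd2 : Integrable (fun p : Vec d × Vec d => ‖p.2‖ ^ 2) γstar := by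
    rw [← hγstar.2] at hν2
    exact hν2.comp_measurable measurable_snd
  have hint : Integrable (fun p : Vec d × Vec d => spoLoss wstar p.1 p.2) γstar := by
    refine Integrable.mono' (((integrable_const (1 : ℝ)).add hsnd2).mul_const (2 * C))
      hmeas.aestronglyMeasurable (Filter.Eventually.of_forall fun p => ?_)
    rw [Real.norm_of_nonneg (hnn _ _)]
    have h1 := abs_le.1 (abs_real_inner_le_norm p.2 (wstar p.1))
    have h2 := abs_le.1 (abs_real_inner_le_norm p.2 (wstar p.2))
    have h3 := mul_le_mul_of_nonneg_left (hC _ (hmemS p.1)) (norm_nonneg p.2)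
    have h4 := mul_le_mul_of_nonneg_left (hC _ (hmemS p.2)) (norm_nonneg p.2)
    have hC0 : 0 ≤ C := (norm_nonneg _).trans (hC _ (hmemS p.1))
    have h5 : ‖p.2‖ ≤ 1 + ‖p.2‖ ^ 2 := by nlinarith [sq_nonneg (‖p.2‖ - 1), norm_nonneg p.2]
    have h6 := mul_le_mul_of_nonneg_right h5 hC0
    simp only [spoLoss, Pi.add_apply]
    linarith [h1.2, h2.1]
  have hπ : Measurable (fun p : Vec d × Vec d => (1 - t) • p.1 + t • p.2) := by fun_prop
  have hF : Measurable (fun p : Vec d × Vec d => (p.1, (1 - t) • p.1 + t • p.2)) :=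
    measurable_fst.prodMk hπ
  have hle : WDFO wstar μ (γstar.map (fun p => (1 - t) • p.1 + t • p.2)) ≤
      ∫ p, spoLoss wstar p.1 p.2 ∂(γstar.map (fun p => (p.1, (1 - t) • p.1 + t • p.2))) := by
    refine csInf_le ⟨0, ?_⟩ ⟨_, ⟨?_, ?_⟩, rfl⟩
    · rintro r ⟨γ, -, rfl⟩
      exact integral_nonneg fun p => hnn _ _
    · rw [Measure.map_map measurable_fst hF]
      exact hγstar.1
    · rw [Measure.map_map measurable_snd hF]
      rfl
  refine hle.trans ?_
  rw [integral_map hF.aemeasurable hmeas.aestronglyMeasurable, ← hγopt, ← integral_const_mul]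
  refine integral_mono_of_nonneg (Filter.Eventually.of_forall fun p => hnn _ _)
    (hint.const_mul t) (Filter.Eventually.of_forall fun p => ?_)
  obtain ⟨u, v⟩ := p
  simp only [spoLoss]
  generalize hy : wstar ((1 - t) • u + t • v) = w
  have h1 : ⟪u, wstar u⟫ ≤ ⟪u, w⟫ := hy ▸ hopt u _
  have h2 : ⟪v, wstar v⟫ ≤ ⟪v, w⟫ := hy ▸ hopt v _
  simp only [inner_add_left, real_inner_smul_left]
  have h3 := mul_le_mul_of_nonneg_left h1 (sub_nonneg.2 ht.2)
  have h4 := mul_le_mul_of_nonneg_left h2 ht.1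
  linarith
end
end
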